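/- There exists ε̄ > 0 such that for every 0 < ε < ε̄, every global minimizer μ̄ of E_{ε,A} over Borel probability measures on S, and every measurable h : S → ℝ with ∫_S h² dμ̄ < ∞ and ∫_S h dμ̄ = 0, one has (ε/2)·(1 − λ_2/λ_1)·∫_S h² dμ̄ ≤ ε·∫_S h² dμ̄ − ∬_{S×S} K_A(x,y) h(x) h(y) dμ̄(x) dμ̄(y) ≤ ε·∫_S h² dμ̄. -/

import Mathlib

open MeasureTheory Real Filter Topology

noncomputable section

/-- The unit sphere `S = 𝕊^{d-1}` in `ℝ^d`. -/
abbrev Sph (d : ℕ) : Type := Metric.sphere (0 : EuclideanSpace ℝ (Fin d)) 1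

variable {d : ℕ}

/-- The bilinear form `⟨x, A y⟩` for the diagonal matrix `A = diag lam`. -/
def qA (lam : Fin d → ℝ) (x y : EuclideanSpace ℝ (Fin d)) : ℝ :=
  ∑ i, lam i * x i * y i

/-- The interaction kernel `K_A(x,y) = exp ⟨x, A y⟩`. -/
def Kker (lam : Fin d → ℝ) (x y : Sph d) : ℝ :=
  Real.exp (qA lam (x : EuclideanSpace ℝ (Fin d)) (y : EuclideanSpace ℝ (Fin d)))

/-- The interaction energy `I_A(μ)`. -/
def IA (lam : Fin d → ℝ) (μ : Measure (Sph d)) : ℝ :=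
  ∫ x, ∫ y, Kker lam x y ∂μ ∂μ

/-- The potential `W_μ(x) = ∫ K_A(x,y) dμ(y)`. -/
def WA (lam : Fin d → ℝ) (μ : Measure (Sph d)) (x : Sph d) : ℝ :=
  ∫ y, Kker lam x y ∂μ

open scoped Classical in
/-- Relative entropy of `μ` with respect to `ω`, with value `+∞` when `μ` is not
absolutely continuous w.r.t. `ω` or the entropy integral diverges. -/
def Ent (ω μ : Measure (Sph d)) : EReal :=
  if μ ≪ ω ∧ Integrable (fun x => Real.log (μ.rnDeriv ω x).toReal) μ
  then ((∫ x, Real.log (μ.rnDeriv ω x).toReal ∂μ : ℝ) : EReal)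
  else ⊤

/-- The free energy `E_{ε,A}(μ) = ε·Ent(μ) − (1/2)·I_A(μ)`. -/
def EA (lam : Fin d → ℝ) (ω : Measure (Sph d)) (ε : ℝ) (μ : Measure (Sph d)) : EReal :=
  (ε : EReal) * Ent ω μ - ((IA lam μ / 2 : ℝ) : EReal)

/-- The antipodal map on the sphere. -/
def antip (x : Sph d) : Sph d :=
  ⟨-(x : EuclideanSpace ℝ (Fin d)), by
    have hx := x.2
    rw [mem_sphere_zero_iff_norm] at hx ⊢
    rwa [norm_neg]⟩

/-- The sphere self-map induced by a linear isometry equivalence of `ℝ^d`. -/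
def sphMap (g : EuclideanSpace ℝ (Fin d) ≃ₗᵢ[ℝ] EuclideanSpace ℝ (Fin d)) (x : Sph d) : Sph d :=
  ⟨g (x : EuclideanSpace ℝ (Fin d)), by
    have hx := x.2
    rw [mem_sphere_zero_iff_norm] at hx ⊢
    rwa [g.norm_map]⟩

/-- `ω` is the uniform probability measure on the sphere, characterised as a
rotation-invariant Borel probability measure. -/
def IsUniform (ω : Measure (Sph d)) : Prop :=
  IsProbabilityMeasure ω ∧
  ∀ g : EuclideanSpace ℝ (Fin d) ≃ₗᵢ[ℝ] EuclideanSpace ℝ (Fin d),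
    Measure.map (sphMap g) ω = ω

/-- The (topological) support of a measure. -/
def msupport (μ : Measure (Sph d)) : Set (Sph d) :=
  {x | ∀ U : Set (Sph d), IsOpen U → x ∈ U → 0 < μ U}

/-- The set of global maximizers of the potential `W_ν`. -/
def argmaxW (lam : Fin d → ℝ) (ν : Measure (Sph d)) : Set (Sph d) :=
  {x | ∀ y, WA lam ν y ≤ WA lam ν x}

/-- `μ` is a Gibbs critical point of `E_{ε,A}`. -/
def IsGibbs (lam : Fin d → ℝ) (ω : Measure (Sph d)) (ε : ℝ) (μ : Measure (Sph d)) : Prop :=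
  IsProbabilityMeasure μ ∧
  μ = ω.withDensity (fun x => ENNReal.ofReal
    (Real.exp (WA lam μ x / ε) / ∫ z, Real.exp (WA lam μ z / ε) ∂ω))

/-- `μ` is a global minimizer of `E_{ε,A}` over Borel probability measures. -/
def IsMinimizer (lam : Fin d → ℝ) (ω : Measure (Sph d)) (ε : ℝ) (μ : Measure (Sph d)) : Prop :=
  IsProbabilityMeasure μ ∧
  ∀ ν : Measure (Sph d), IsProbabilityMeasure ν → EA lam ω ε μ ≤ EA lam ω ε ν

/-- `m_ε`, the infimum of the free energy over probability measures. -/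
def mEps (lam : Fin d → ℝ) (ω : Measure (Sph d)) (ε : ℝ) : EReal :=
  sInf {r : EReal | ∃ μ : Measure (Sph d), IsProbabilityMeasure μ ∧ EA lam ω ε μ = r}

/-- Structural hypotheses on the spectrum, with distinguished top index. -/
def Hyp (lam : Fin d → ℝ) (i0 : Fin d) (l : ℝ) : Prop :=
  0 < l ∧ l < lam i0 ∧ (∀ i, 0 < lam i) ∧ ∀ i, i ≠ i0 → lam i ≤ l

/-- Square root of the defect `1 - σ x₁`. -/
def al (i0 : Fin d) (σ : ℝ) (x : Sph d) : ℝ := Real.sqrt (1 - σ * x.1 i0)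

lemma sph_sq (x : Sph d) : ∑ i, (x.1 i) ^ 2 = 1 := by
  have h := x.2
  rw [mem_sphere_zero_iff_norm] at h
  have h2 := EuclideanSpace.norm_sq_eq (𝕜 := ℝ) x.1
  rw [h] at h2
  simpa using h2.symm

lemma sph_split (i0 : Fin d) (x : Sph d) :
    ∑ i ∈ Finset.univ.erase i0, (x.1 i) ^ 2 = 1 - (x.1 i0) ^ 2 := by
  have h := sph_sq x
  rw [← Finset.add_sum_erase _ _ (Finset.mem_univ i0)] at h
  linarith

lemma coord_sq_le (x : Sph d) (i : Fin d) : (x.1 i) ^ 2 ≤ 1 := by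
  refine le_trans ?_ (sph_sq x).le
  exact Finset.single_le_sum (f := fun i => (x.1 i) ^ 2) (fun j _ => sq_nonneg _)
    (Finset.mem_univ i)

lemma coord_abs_le (x : Sph d) (i : Fin d) : |x.1 i| ≤ 1 :=
  (sq_le_one_iff_abs_le_one _).1 (coord_sq_le x i)

lemma defect_nonneg (i0 : Fin d) {σ : ℝ} (hσ : σ = 1 ∨ σ = -1) (x : Sph d) :
    0 ≤ 1 - σ * x.1 i0 := by
  have := abs_le.1 (coord_abs_le x i0)
  rcases hσ with rfl | rfl <;> linarith [this.1, this.2]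

lemma defect_le (i0 : Fin d) {σ : ℝ} (hσ : σ = 1 ∨ σ = -1) (x : Sph d) :
    1 - σ * x.1 i0 ≤ 2 := by
  have := abs_le.1 (coord_abs_le x i0)
  rcases hσ with rfl | rfl <;> linarith [this.1, this.2]

lemma al_nonneg (i0 : Fin d) (σ : ℝ) (x : Sph d) : 0 ≤ al i0 σ x := Real.sqrt_nonneg _

lemma al_sq (i0 : Fin d) {σ : ℝ} (hσ : σ = 1 ∨ σ = -1) (x : Sph d) :
    al i0 σ x ^ 2 = 1 - σ * x.1 i0 := Real.sq_sqrt (defect_nonneg i0 hσ x)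

lemma al_le (i0 : Fin d) {σ : ℝ} (hσ : σ = 1 ∨ σ = -1) (x : Sph d) : al i0 σ x ≤ 2 := by
  have h1 := al_sq i0 hσ x
  have h2 := defect_le i0 hσ x
  nlinarith [al_nonneg i0 σ x]

lemma coord_le_al (i0 : Fin d) {σ : ℝ} (hσ : σ = 1 ∨ σ = -1) (x : Sph d) (i : Fin d)
    (hi : i ≠ i0) : |x.1 i| ≤ 2 * al i0 σ x := by
  have h1 : (x.1 i) ^ 2 ≤ 1 - (x.1 i0) ^ 2 := by
    rw [← sph_split i0 x]
    exact Finset.single_le_sum (f := fun i => (x.1 i) ^ 2) (fun j _ => sq_nonneg _)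
      (Finset.mem_erase.2 ⟨hi, Finset.mem_univ i⟩)
  have h2 := al_sq i0 hσ x
  have h3 := defect_nonneg i0 hσ x
  have h4 := defect_le i0 hσ x
  apply abs_le_of_sq_le_sq _ (by linarith [al_nonneg i0 σ x])
  have : (x.1 i0)^2 = (σ * x.1 i0)^2 := by rcases hσ with rfl | rfl <;> ring
  rw [mul_pow, h2]
  nlinarith

/-- The transversal part of the bilinear form. -/
def Qp (lam : Fin d → ℝ) (i0 : Fin d) (x y : Sph d) : ℝ :=
  ∑ i ∈ Finset.univ.erase i0, lam i * x.1 i * y.1 i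

lemma qA_split (lam : Fin d → ℝ) (i0 : Fin d) (x y : Sph d) :
    qA lam x.1 y.1 = lam i0 * x.1 i0 * y.1 i0 + Qp lam i0 x y := by
  unfold qA Qp
  rw [← Finset.add_sum_erase _ _ (Finset.mem_univ i0)]

lemma lam_le {lam : Fin d → ℝ} {i0 : Fin d} {l : ℝ} (H : Hyp lam i0 l) (i : Fin d) :
    lam i ≤ lam i0 := by
  by_cases h : i = i0
  · rw [h]
  · exact (H.2.2.2 i h).trans H.2.1.le

lemma Qp_abs_le {lam : Fin d → ℝ} {i0 : Fin d} {l : ℝ} (H : Hyp lam i0 l)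
    {σ : ℝ} (hσ : σ = 1 ∨ σ = -1) (x y : Sph d) :
    |Qp lam i0 x y| ≤ 4 * d * lam i0 * (al i0 σ x * al i0 σ y) := by
  unfold Qp
  refine (Finset.abs_sum_le_sum_abs _ _).trans ?_
  have : ∀ i ∈ Finset.univ.erase i0, |lam i * x.1 i * y.1 i| ≤
      4 * lam i0 * (al i0 σ x * al i0 σ y) := by
    intro i hi
    have hi' := (Finset.mem_erase.1 hi).1
    rw [abs_mul, abs_mul, abs_of_pos (H.2.2.1 i)]
    have h1 := coord_le_al i0 hσ x i hi'
    have h2 := coord_le_al i0 hσ y i hi'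
    have h3 := lam_le H i
    calc lam i * |x.1 i| * |y.1 i| ≤ lam i0 * (2 * al i0 σ x) * (2 * al i0 σ y) := by
          gcongr
          · exact mul_nonneg (H.2.2.1 i0).le (by linarith [al_nonneg i0 σ x])
          · exact (H.2.2.1 i0).le
      _ = _ := by ring
  refine (Finset.sum_le_card_nsmul _ _ _ this).trans ?_
  rw [nsmul_eq_mul]
  have hc : ((Finset.univ.erase i0).card : ℝ) ≤ d := by
    have := Finset.card_erase_le (s := (Finset.univ : Finset (Fin d))) (a := i0)
    simp only [Finset.card_univ, Fintype.card_fin] at this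
    exact_mod_cast this
  have hp : 0 ≤ 4 * lam i0 * (al i0 σ x * al i0 σ y) := by
    have := H.2.2.1 i0
    have := al_nonneg i0 σ x
    have := al_nonneg i0 σ y
    positivity
  nlinarith

lemma Qp_le {lam : Fin d → ℝ} {i0 : Fin d} {l : ℝ} (H : Hyp lam i0 l) (x y : Sph d) :
    Qp lam i0 x y ≤ l * (1 - x.1 i0 * y.1 i0) := by
  have h1 : Qp lam i0 x y ≤ ∑ i ∈ Finset.univ.erase i0, l / 2 * ((x.1 i)^2 + (y.1 i)^2) := by
    apply Finset.sum_le_sum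
    intro i hi
    have hi' := (Finset.mem_erase.1 hi).1
    have := H.2.2.1 i
    have := H.2.2.2 i hi'
    nlinarith [mul_nonneg (H.2.2.1 i).le (sq_nonneg (x.1 i - y.1 i)),
      mul_nonneg (sub_nonneg.2 this) (add_nonneg (sq_nonneg (x.1 i)) (sq_nonneg (y.1 i)))]
  rw [← Finset.mul_sum, Finset.sum_add_distrib, sph_split, sph_split] at h1
  nlinarith [mul_nonneg H.1.le (sq_nonneg (x.1 i0 - y.1 i0))]

lemma Qp_neg_le {lam : Fin d → ℝ} {i0 : Fin d} {l : ℝ} (H : Hyp lam i0 l) (x y : Sph d) :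
    -Qp lam i0 x y ≤ l * (1 + x.1 i0 * y.1 i0) := by
  have h1 : -Qp lam i0 x y ≤ ∑ i ∈ Finset.univ.erase i0, l / 2 * ((x.1 i)^2 + (y.1 i)^2) := by
    unfold Qp
    rw [← Finset.sum_neg_distrib]
    apply Finset.sum_le_sum
    intro i hi
    have hi' := (Finset.mem_erase.1 hi).1
    have := H.2.2.1 i
    have := H.2.2.2 i hi'
    nlinarith [mul_nonneg (H.2.2.1 i).le (sq_nonneg (x.1 i + y.1 i)),
      mul_nonneg (sub_nonneg.2 this) (add_nonneg (sq_nonneg (x.1 i)) (sq_nonneg (y.1 i)))]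
  rw [← Finset.mul_sum, Finset.sum_add_distrib, sph_split, sph_split] at h1
  nlinarith [mul_nonneg H.1.le (sq_nonneg (x.1 i0 + y.1 i0))]

lemma x0y0_abs (i0 : Fin d) (x y : Sph d) : |x.1 i0 * y.1 i0| ≤ 1 := by
  rw [abs_mul]
  exact mul_le_one₀ (coord_abs_le x i0) (abs_nonneg _) (coord_abs_le y i0)

lemma qA_gap {lam : Fin d → ℝ} {i0 : Fin d} {l : ℝ} (H : Hyp lam i0 l) (x y : Sph d) :
    (lam i0 - l) * (1 - x.1 i0 * y.1 i0) ≤ lam i0 - qA lam x.1 y.1 := by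
  rw [qA_split lam i0]
  nlinarith [Qp_le H x y]

lemma qA_le {lam : Fin d → ℝ} {i0 : Fin d} {l : ℝ} (H : Hyp lam i0 l) (x y : Sph d) :
    qA lam x.1 y.1 ≤ lam i0 := by
  have := qA_gap H x y
  have h2 := abs_le.1 (x0y0_abs i0 x y)
  nlinarith [H.2.1]

lemma le_qA {lam : Fin d → ℝ} {i0 : Fin d} {l : ℝ} (H : Hyp lam i0 l) (x y : Sph d) :
    -lam i0 ≤ qA lam x.1 y.1 := by
  rw [qA_split lam i0]
  have := Qp_neg_le H x y
  have h2 := abs_le.1 (x0y0_abs i0 x y)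
  nlinarith [H.2.1]

lemma Kker_pos (lam : Fin d → ℝ) (x y : Sph d) : 0 < Kker lam x y := Real.exp_pos _

lemma Kker_le {lam : Fin d → ℝ} {i0 : Fin d} {l : ℝ} (H : Hyp lam i0 l) (x y : Sph d) :
    Kker lam x y ≤ Real.exp (lam i0) := Real.exp_le_exp.2 (qA_le H x y)

/-- Lower bound on the kernel defect. -/
lemma Kker_gap {lam : Fin d → ℝ} {i0 : Fin d} {l : ℝ} (H : Hyp lam i0 l) (x y : Sph d) :
    Real.exp (-lam i0) * ((lam i0 - l) * (1 - x.1 i0 * y.1 i0)) ≤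
      Real.exp (lam i0) - Kker lam x y := by
  have h1 := qA_gap H x y
  have h2 := le_qA H x y
  have h3 := qA_le H x y
  unfold Kker
  set q := qA lam x.1 y.1
  have h4 : Real.exp q * (lam i0 - q + 1) ≤ Real.exp (lam i0) := by
    have := Real.add_one_le_exp (lam i0 - q)
    calc Real.exp q * (lam i0 - q + 1) ≤ Real.exp q * Real.exp (lam i0 - q) := by gcongr
      _ = _ := by rw [← Real.exp_add]; ring_nf
  have h5 : Real.exp (-lam i0) ≤ Real.exp q := Real.exp_le_exp.2 h2
  have h6 : Real.exp (-lam i0) * ((lam i0 - l) * (1 - x.1 i0 * y.1 i0)) ≤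
      Real.exp q * (lam i0 - q) := by
    apply (mul_le_mul_of_nonneg_left h1 (Real.exp_pos _).le).trans
    exact mul_le_mul_of_nonneg_right h5 (by linarith)
  linarith

lemma x0y0_eq (i0 : Fin d) {σ : ℝ} (hσ : σ = 1 ∨ σ = -1) (x y : Sph d) :
    x.1 i0 * y.1 i0 = 1 - al i0 σ x ^ 2 - al i0 σ y ^ 2 + al i0 σ x ^ 2 * al i0 σ y ^ 2 := by
  rw [al_sq i0 hσ, al_sq i0 hσ]
  rcases hσ with rfl | rfl <;> ring

/-- First-order estimate. -/
lemma Kker_first (lam : Fin d → ℝ) (i0 : Fin d) (l : ℝ) (H : Hyp lam i0 l) :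
    ∃ C : ℝ, 0 < C ∧ ∀ σ : ℝ, (σ = 1 ∨ σ = -1) → ∀ x y : Sph d,
      |Kker lam x y - Real.exp (lam i0)| ≤ C * (al i0 σ x ^ 2 + al i0 σ y ^ 2) := by
  have hL := H.2.2.1 i0
  refine ⟨Real.exp (lam i0) * ((2 * d + 1) * lam i0), by positivity, ?_⟩
  intro σ hσ x y
  have h1 := Kker_le H x y
  rw [abs_sub_comm, abs_of_nonneg (by linarith), mul_assoc]
  have h2 : Real.exp (lam i0) - Kker lam x y ≤
      Real.exp (lam i0) * (lam i0 - qA lam x.1 y.1) := by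
    unfold Kker
    have := Real.add_one_le_exp (qA lam x.1 y.1 - lam i0)
    have h3 : Real.exp (qA lam x.1 y.1) = Real.exp (lam i0) *
      Real.exp (qA lam x.1 y.1 - lam i0) := by rw [← Real.exp_add]; ring_nf
    rw [h3]
    nlinarith [Real.exp_pos (lam i0)]
  refine h2.trans (mul_le_mul_of_nonneg_left ?_ (Real.exp_pos _).le)
  rw [qA_split lam i0, mul_assoc, x0y0_eq i0 hσ]
  have h5 := (abs_le.1 (Qp_abs_le H hσ x y)).1
  have h6 : 0 ≤ lam i0 * (al i0 σ x ^ 2 * al i0 σ y ^ 2) := by positivity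
  have h7 : 0 ≤ d * lam i0 * (al i0 σ x - al i0 σ y) ^ 2 := by positivity
  nlinarith

lemma exp_taylor2 (p : ℝ) : |Real.exp p - 1 - p| ≤ p ^ 2 * Real.exp |p| := by
  have h0 := Real.add_one_le_exp p
  rw [abs_of_nonneg (by linarith)]
  have h1 : Real.exp p - 1 ≤ p * Real.exp p := by
    have h := Real.add_one_le_exp (-p)
    have h2 : Real.exp p * Real.exp (-p) = 1 := by rw [← Real.exp_add]; simp
    nlinarith [Real.exp_pos p]
  rcases le_total 0 p with hp | hp
  · rw [abs_of_nonneg hp]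
    nlinarith
  · rw [abs_of_nonpos hp]
    have h3 : 1 ≤ Real.exp (-p) := Real.one_le_exp (by linarith)
    have h4 : Real.exp p - 1 - p ≤ p * (Real.exp p - 1) := by linarith
    nlinarith [sq_nonneg p]

set_option maxHeartbeats 1000000 in
/-- Second-order estimate. -/
lemma Kker_second (lam : Fin d → ℝ) (i0 : Fin d) (l : ℝ) (H : Hyp lam i0 l) :
    ∃ C : ℝ, 0 < C ∧ ∀ σ : ℝ, (σ = 1 ∨ σ = -1) → ∀ x y : Sph d,
      |Kker lam x y / Real.exp (lam i0) -
        (Real.exp (-lam i0 * al i0 σ x ^ 2) + Real.exp (-lam i0 * al i0 σ y ^ 2) - 1)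
        - Qp lam i0 x y| ≤
        C * ((al i0 σ x ^ 2 + al i0 σ y ^ 2) * (al i0 σ x * al i0 σ y)) := by
  have hL := H.2.2.1 i0
  set L := lam i0 with hLdef
  set D : ℝ := 4 * d * L + 4 * L with hD
  have hDpos : 0 < D := by positivity
  refine ⟨(L ^ 2 + L) + L * D + D ^ 2 * Real.exp (4 * D), by positivity, ?_⟩
  intro σ hσ x y
  have ha := al_nonneg i0 σ x
  have hb := al_nonneg i0 σ y
  have ha2 := al_le i0 hσ x
  have hb2 := al_le i0 hσ y
  have hQ := Qp_abs_le H hσ x y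
  have hK : Kker lam x y / Real.exp L = Real.exp (-L * al i0 σ x ^ 2) *
      Real.exp (-L * al i0 σ y ^ 2) *
      Real.exp (L * (al i0 σ x ^ 2 * al i0 σ y ^ 2) + Qp lam i0 x y) := by
    unfold Kker
    rw [qA_split lam i0, mul_assoc, x0y0_eq i0 hσ, ← Real.exp_sub, ← Real.exp_add, ← Real.exp_add]
    congr 1
    rw [← hLdef]; ring
  rw [hK]
  set a := al i0 σ x
  set b := al i0 σ y
  set Q := Qp lam i0 x y
  set g := Real.exp (-L * a ^ 2) with hg
  set k := Real.exp (-L * b ^ 2) with hk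
  have hg1 : g ≤ 1 := Real.exp_le_one_iff.2 (by nlinarith [sq_nonneg a])
  have hk1 : k ≤ 1 := Real.exp_le_one_iff.2 (by nlinarith [sq_nonneg b])
  have hg0 : 0 < g := Real.exp_pos _
  have hk0 : 0 < k := Real.exp_pos _
  have hg2 : 1 - g ≤ L * a ^ 2 := by linarith [Real.add_one_le_exp (-L * a ^ 2)]
  have hk2 : 1 - k ≤ L * b ^ 2 := by linarith [Real.add_one_le_exp (-L * b ^ 2)]
  set p := L * (a ^ 2 * b ^ 2) + Q with hp
  have hab : 0 ≤ a * b := mul_nonneg ha hb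
  have hab4 : a * b ≤ 4 := by nlinarith
  have hQD : |Q| ≤ D * (a * b) := hQ.trans (by rw [hD]; nlinarith [mul_nonneg hL.le hab])
  have hpD : |p| ≤ D * (a * b) := by
    refine (abs_add_le _ _).trans ?_
    rw [abs_of_nonneg (by positivity : (0:ℝ) ≤ L * (a ^ 2 * b ^ 2))]
    have : L * (a ^ 2 * b ^ 2) ≤ 4 * L * (a * b) := by
      have : a ^ 2 * b ^ 2 = (a * b) * (a * b) := by ring
      rw [this]
      nlinarith [mul_nonneg hL.le hab]
    rw [hD]; linarith
  have hR := exp_taylor2 p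
  have hR2 : p ^ 2 * Real.exp |p| ≤ D ^ 2 * Real.exp (4 * D) * (a * b) ^ 2 := by
    have h1 : p ^ 2 ≤ (D * (a * b)) ^ 2 := by
      rw [← sq_abs p]; gcongr
    have h2 : Real.exp |p| ≤ Real.exp (4 * D) := by
      apply Real.exp_le_exp.2; nlinarith
    calc p ^ 2 * Real.exp |p| ≤ (D * (a * b)) ^ 2 * Real.exp (4 * D) := by gcongr
      _ = _ := by ring
  set r := Real.exp p - 1 - p with hr
  have hexp : Real.exp p = 1 + p + r := by rw [hr]; ring
  rw [hexp]
  have hs : (a * b) ^ 2 ≤ (a ^ 2 + b ^ 2) * (a * b) := by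
    nlinarith [sq_nonneg (a - b)]
  have e1 : g * k * (1 + p + r) - (g + k - 1) - Q =
      (1 - g) * (1 - k) + g * k * (L * (a ^ 2 * b ^ 2)) + (g * k - 1) * Q + g * k * r := by
    rw [hp]; ring
  have hgk1 : g * k ≤ 1 := mul_le_one₀ hg1 hk0.le hk1
  have hgk0 : 0 < g * k := by positivity
  rw [e1]
  have t1 : |(1 - g) * (1 - k)| ≤ L ^ 2 * (a * b) ^ 2 := by
    rw [abs_of_nonneg (mul_nonneg (by linarith) (by linarith))]
    calc (1 - g) * (1 - k) ≤ (L * a ^ 2) * (L * b ^ 2) := by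
          apply mul_le_mul hg2 hk2 (by linarith) (by positivity)
      _ = _ := by ring
  have t2 : |g * k * (L * (a ^ 2 * b ^ 2))| ≤ L * (a * b) ^ 2 := by
    rw [abs_of_nonneg (by positivity)]
    have : 0 ≤ L * (a ^ 2 * b ^ 2) := by positivity
    calc g * k * (L * (a ^ 2 * b ^ 2)) ≤ 1 * (L * (a ^ 2 * b ^ 2)) := by gcongr
      _ = _ := by ring
  have t3 : |(g * k - 1) * Q| ≤ L * D * ((a ^ 2 + b ^ 2) * (a * b)) := by
    rw [abs_mul, abs_sub_comm, abs_of_nonneg (by linarith)]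
    have : 1 - g * k ≤ L * (a ^ 2 + b ^ 2) := by
      have w1 : g * (1 - k) ≤ 1 * (1 - k) := mul_le_mul_of_nonneg_right hg1 (by linarith)
      have w2 : 1 - g * k = (1 - g) + g * (1 - k) := by ring
      rw [w2]; linarith
    calc (1 - g * k) * |Q| ≤ (L * (a ^ 2 + b ^ 2)) * (D * (a * b)) := by
          apply mul_le_mul this hQD (abs_nonneg _) (by positivity)
      _ = _ := by ring
  have t4 : |g * k * r| ≤ D ^ 2 * Real.exp (4 * D) * (a * b) ^ 2 := by
    rw [abs_mul, abs_of_pos hgk0]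
    have w1 : g * k * |r| ≤ 1 * |r| := mul_le_mul_of_nonneg_right hgk1 (abs_nonneg r)
    linarith
  have tt := abs_add_le ((1 - g) * (1 - k) + g * k * (L * (a ^ 2 * b ^ 2)) + (g * k - 1) * Q)
    (g * k * r)
  have tt2 := abs_add_le ((1 - g) * (1 - k) + g * k * (L * (a ^ 2 * b ^ 2))) ((g * k - 1) * Q)
  have tt3 := abs_add_le ((1 - g) * (1 - k)) (g * k * (L * (a ^ 2 * b ^ 2)))
  have u1 : L ^ 2 * (a * b) ^ 2 ≤ L ^ 2 * ((a ^ 2 + b ^ 2) * (a * b)) := by gcongr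
  have u2 : L * (a * b) ^ 2 ≤ L * ((a ^ 2 + b ^ 2) * (a * b)) := by gcongr
  have u4 : D ^ 2 * Real.exp (4 * D) * (a * b) ^ 2 ≤
    D ^ 2 * Real.exp (4 * D) * ((a ^ 2 + b ^ 2) * (a * b)) := by gcongr
  linarith

/-- The potential is close to the one of a Dirac mass. -/
lemma Kker_dirac (lam : Fin d → ℝ) (i0 : Fin d) (l : ℝ) (H : Hyp lam i0 l) :
    ∃ C : ℝ, 0 < C ∧ ∀ σ : ℝ, (σ = 1 ∨ σ = -1) → ∀ x y : Sph d,
      |Kker lam x y - Real.exp (lam i0 - lam i0 * al i0 σ x ^ 2)| ≤ C * al i0 σ y := by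
  have hL := H.2.2.1 i0
  refine ⟨Real.exp (lam i0) * (8 * d * lam i0 + 2 * lam i0), by positivity, ?_⟩
  intro σ hσ x y
  have key : ∀ u v M : ℝ, u ≤ M → v ≤ M → |Real.exp u - Real.exp v| ≤ Real.exp M * |u - v| := by
    have key1 : ∀ u v M : ℝ, u ≤ M → v ≤ u → Real.exp u - Real.exp v ≤ Real.exp M * (u - v) := by
      intro u v M hu hv
      have h := Real.add_one_le_exp (v - u)
      have h2 : Real.exp v = Real.exp u * Real.exp (v - u) := by rw [← Real.exp_add]; ring_nf
      have h3 := Real.exp_le_exp.2 hu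
      rw [h2]
      nlinarith [Real.exp_pos u]
    intro u v M hu hv
    rcases le_total v u with h | h
    · rw [abs_of_nonneg (by linarith [Real.exp_le_exp.2 h]), abs_of_nonneg (by linarith)]
      exact key1 u v M hu h
    · rw [abs_sub_comm, abs_sub_comm u,
        abs_of_nonneg (by linarith [Real.exp_le_exp.2 h]), abs_of_nonneg (by linarith)]
      exact key1 v u M hv h
  have ha := al_nonneg i0 σ x
  have hb := al_nonneg i0 σ y
  have ha2 := al_le i0 hσ x
  have hb2 := al_le i0 hσ y
  have hQ := Qp_abs_le H hσ x y
  unfold Kker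
  refine (key _ _ (lam i0) (qA_le H x y) (by nlinarith [mul_nonneg hL.le (sq_nonneg (al i0 σ x))])).trans ?_
  rw [mul_assoc]
  refine mul_le_mul_of_nonneg_left ?_ (Real.exp_pos _).le
  rw [qA_split lam i0, mul_assoc, x0y0_eq i0 hσ]
  have e : lam i0 * (1 - al i0 σ x ^ 2 - al i0 σ y ^ 2 + al i0 σ x ^ 2 * al i0 σ y ^ 2) +
      Qp lam i0 x y - (lam i0 - lam i0 * al i0 σ x ^ 2) =
      -(lam i0 * (al i0 σ y ^ 2 * (1 - al i0 σ x ^ 2))) + Qp lam i0 x y := by ring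
  rw [e]
  refine (abs_add_le _ _).trans ?_
  have h3 : |1 - al i0 σ x ^ 2| ≤ 1 := by
    have := defect_le i0 hσ x
    rw [← al_sq i0 hσ] at this
    rw [abs_le]; constructor <;> nlinarith [sq_nonneg (al i0 σ x)]
  rw [abs_neg, abs_mul, abs_mul, abs_of_pos hL, abs_of_nonneg (sq_nonneg (al i0 σ y))]
  have h4 : lam i0 * (al i0 σ y ^ 2 * |1 - al i0 σ x ^ 2|) ≤ lam i0 * (2 * al i0 σ y) := by
    refine mul_le_mul_of_nonneg_left ?_ hL.le
    have w1 := mul_le_mul_of_nonneg_left h3 (sq_nonneg (al i0 σ y))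
    have w2 := mul_le_mul_of_nonneg_right hb2 hb
    linarith [sq (al i0 σ y)]
  have h5 : 4 * d * lam i0 * (al i0 σ x * al i0 σ y) ≤ 4 * d * lam i0 * (2 * al i0 σ y) := by
    gcongr
  linarith

lemma cont_coord (i : Fin d) : Continuous (fun x : Sph d => x.1 i) := by fun_prop

lemma cont_al (i0 : Fin d) (σ : ℝ) : Continuous (al i0 σ) := by
  unfold al; fun_prop

lemma cont_qA (lam : Fin d → ℝ) : Continuous (fun z : Sph d × Sph d => qA lam z.1.1 z.2.1) := by
  unfold qA; fun_prop

lemma cont_K (lam : Fin d → ℝ) : Continuous (fun z : Sph d × Sph d => Kker lam z.1 z.2) := by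
  unfold Kker
  exact Real.continuous_exp.comp (cont_qA lam)

lemma K_symm (lam : Fin d → ℝ) (x y : Sph d) : Kker lam x y = Kker lam y x := by
  unfold Kker qA
  congr 1
  apply Finset.sum_congr rfl
  intro i _; ring

lemma cint {X : Type*} [TopologicalSpace X] [CompactSpace X] [MeasurableSpace X]
    [OpensMeasurableSpace X] (μ : Measure X) [IsFiniteMeasure μ] {f : X → ℝ} (hf : Continuous f) :
    Integrable f μ :=
  hf.integrable_of_hasCompactSupport (HasCompactSupport.of_compactSpace f)

lemma cs_int {X : Type*} [MeasurableSpace X] (μ : Measure X) {f h : X → ℝ}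
    (hf : Integrable (fun x => f x ^ 2) μ) (hh : Integrable (fun x => h x ^ 2) μ)
    (hfh : Integrable (fun x => f x * h x) μ) :
    (∫ x, f x * h x ∂μ) ^ 2 ≤ (∫ x, f x ^ 2 ∂μ) * ∫ x, h x ^ 2 ∂μ := by
  have key : ∀ t : ℝ, 0 ≤ (∫ x, f x ^ 2 ∂μ) * (t * t) + (2 * ∫ x, f x * h x ∂μ) * t +
      ∫ x, h x ^ 2 ∂μ := by
    intro t
    have h1 : 0 ≤ ∫ x, (t * f x + h x) ^ 2 ∂μ := integral_nonneg fun x => sq_nonneg _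
    have h2 : (fun x => (t * f x + h x) ^ 2) =
        fun x => (t * t) * f x ^ 2 + (2 * t) * (f x * h x) + h x ^ 2 := by
      funext x; ring
    rw [h2, integral_add ((hf.const_mul _).fun_add (hfh.const_mul _)) hh,
      integral_add (hf.const_mul _) (hfh.const_mul _), integral_const_mul, integral_const_mul] at h1
    linarith
  have := discrim_le_zero key
  unfold discrim at this
  nlinarith

lemma kint (μ : Measure (Sph d)) [IsFiniteMeasure μ] {k : Sph d × Sph d → ℝ} (hk : Continuous k)
    {f g : Sph d → ℝ} (hf : Integrable f μ) (hg : Integrable g μ) :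
    Integrable (fun z : Sph d × Sph d => k z * (f z.1 * g z.2)) (μ.prod μ) := by
  obtain ⟨c, hc⟩ := (isCompact_univ (X := Sph d × Sph d)).exists_bound_of_continuousOn
    hk.continuousOn
  exact (hf.mul_prod hg).bdd_mul hk.aestronglyMeasurable
    (Eventually.of_forall fun x => hc x (Set.mem_univ _))

lemma cint_mul (μ : Measure (Sph d)) [IsFiniteMeasure μ] {k : Sph d → ℝ} (hk : Continuous k)
    {f : Sph d → ℝ} (hf : Integrable f μ) :
    Integrable (fun z : Sph d => k z * f z) μ := by
  obtain ⟨c, hc⟩ := (isCompact_univ (X := Sph d)).exists_bound_of_continuousOn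
    hk.continuousOn
  exact hf.bdd_mul hk.aestronglyMeasurable
    (Eventually.of_forall fun x => hc x (Set.mem_univ _))

lemma h_int (μ : Measure (Sph d)) [IsProbabilityMeasure μ] {h : Sph d → ℝ} (hm : Measurable h)
    (h2 : Integrable (fun x => h x ^ 2) μ) : Integrable h μ :=
  ((memLp_two_iff_integrable_sq hm.aestronglyMeasurable).2 h2).integrable one_le_two

lemma psd_pow (lam : Fin d → ℝ) (hpos : ∀ i, 0 < lam i) (μ : Measure (Sph d))
    [IsProbabilityMeasure μ] (n : ℕ) : ∀ h : Sph d → ℝ, Integrable h μ →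
    0 ≤ ∫ z : Sph d × Sph d, qA lam z.1.1 z.2.1 ^ n * (h z.1 * h z.2) ∂(μ.prod μ) := by
  induction n with
  | zero =>
    intro h hh
    simp only [pow_zero, one_mul]
    rw [integral_prod_mul]
    exact mul_self_nonneg _
  | succ n ih =>
    intro h hh
    have e : (fun z : Sph d × Sph d => qA lam z.1.1 z.2.1 ^ (n+1) * (h z.1 * h z.2)) =
        fun z => ∑ i, lam i * (qA lam z.1.1 z.2.1 ^ n * ((z.1.1 i * h z.1) * (z.2.1 i * h z.2))) := by
      funext z
      rw [pow_succ]
      nth_rewrite 2 [qA]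
      rw [Finset.mul_sum, Finset.sum_mul]
      apply Finset.sum_congr rfl
      intro i _; ring
    rw [e, integral_finsetSum]
    · apply Finset.sum_nonneg
      intro i _
      rw [integral_const_mul]
      exact mul_nonneg (hpos i).le (ih (fun x => x.1 i * h x) (cint_mul μ (cont_coord i) hh))
    · intro i _
      have hi := cint_mul μ (cont_coord i) hh
      exact (kint μ ((cont_qA lam).pow n) hi hi).const_mul _

lemma hess_prod (lam : Fin d → ℝ) (μ : Measure (Sph d)) [IsProbabilityMeasure μ]
    {h : Sph d → ℝ} (hh : Integrable h μ) :
    ∫ x, ∫ y, Kker lam x y * h x * h y ∂μ ∂μ =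
      ∫ z : Sph d × Sph d, Kker lam z.1 z.2 * (h z.1 * h z.2) ∂(μ.prod μ) := by
  rw [integral_prod _ (kint μ (cont_K lam) hh hh)]
  simp only [mul_assoc]

lemma psd_K {lam : Fin d → ℝ} {i0 : Fin d} {l : ℝ} (H : Hyp lam i0 l) (μ : Measure (Sph d))
    [IsProbabilityMeasure μ] {h : Sph d → ℝ} (hh : Integrable h μ) :
    0 ≤ ∫ x, ∫ y, Kker lam x y * h x * h y ∂μ ∂μ := by
  rw [hess_prod lam μ hh]
  have hs : HasSum (fun n : ℕ => ∫ z : Sph d × Sph d,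
      ((n.factorial : ℝ)⁻¹ * (qA lam z.1.1 z.2.1 ^ n * (h z.1 * h z.2))) ∂(μ.prod μ))
      (∫ z : Sph d × Sph d, Kker lam z.1 z.2 * (h z.1 * h z.2) ∂(μ.prod μ)) := by
    have hsum : Summable (fun n : ℕ => lam i0 ^ n / (n.factorial : ℝ)) :=
      Real.summable_pow_div_factorial _
    apply hasSum_integral_of_dominated_convergence
      (fun n z => lam i0 ^ n / (n.factorial : ℝ) * |h z.1 * h z.2|)
    · intro n
      exact ((kint μ ((cont_qA lam).pow n) hh hh).const_mul _).aestronglyMeasurable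
    · intro n
      refine Eventually.of_forall fun z => ?_
      rw [Real.norm_eq_abs, abs_mul, abs_mul, abs_pow, abs_inv, Nat.abs_cast]
      have : |qA lam z.1.1 z.2.1| ≤ lam i0 := abs_le.2 ⟨le_qA H _ _, qA_le H _ _⟩
      calc ((n.factorial : ℝ)⁻¹ * (|qA lam z.1.1 z.2.1| ^ n * |h z.1 * h z.2|))
          ≤ ((n.factorial : ℝ)⁻¹ * (lam i0 ^ n * |h z.1 * h z.2|)) := by gcongr
        _ = _ := by rw [div_eq_mul_inv]; ring
    · exact Eventually.of_forall fun z => hsum.mul_right _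
    · simp_rw [tsum_mul_right]
      exact ((hh.mul_prod hh).abs).const_mul _
    · refine Eventually.of_forall fun z => ?_
      have := (NormedSpace.expSeries_div_hasSum_exp (qA lam z.1.1 z.2.1)).mul_right (h z.1 * h z.2)
      rw [← Real.exp_eq_exp_ℝ] at this
      convert! this using 1
      funext n
      rw [div_eq_mul_inv]; ring
  refine HasSum.nonneg (fun n => ?_) hs
  rw [integral_const_mul]
  exact mul_nonneg (by positivity) (psd_pow lam H.2.2.1 μ n h hh)

lemma integral_coord_sum (lam : Fin d → ℝ) (i0 : Fin d) (μ : Measure (Sph d))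
    [IsProbabilityMeasure μ] {h : Sph d → ℝ} (hh : Integrable h μ) :
    ∫ z : Sph d × Sph d, Qp lam i0 z.1 z.2 * (h z.1 * h z.2) ∂(μ.prod μ) =
      ∑ i ∈ Finset.univ.erase i0, lam i * (∫ x, x.1 i * h x ∂μ) ^ 2 := by
  have e : (fun z : Sph d × Sph d => Qp lam i0 z.1 z.2 * (h z.1 * h z.2)) =
        fun z => ∑ i ∈ Finset.univ.erase i0, lam i * ((z.1.1 i * h z.1) * (z.2.1 i * h z.2)) := by
      funext z
      unfold Qp
      rw [Finset.sum_mul]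
      apply Finset.sum_congr rfl
      intro i _; ring
  rw [e, integral_finsetSum]
  · apply Finset.sum_congr rfl
    intro i _
    rw [integral_const_mul,
      integral_prod_mul (fun x : Sph d => x.1 i * h x) (fun x : Sph d => x.1 i * h x)]
    ring
  · intro i _
    have hi := cint_mul μ (cont_coord i) hh
    exact (hi.mul_prod hi).const_mul _

lemma cs_h (μ : Measure (Sph d)) [IsProbabilityMeasure μ] {f h : Sph d → ℝ} (hf : Continuous f)
    (hh : Integrable h μ) (h2 : Integrable (fun x => h x ^ 2) μ) :
    (∫ x, f x * |h x| ∂μ) ^ 2 ≤ (∫ x, f x ^ 2 ∂μ) * ∫ x, h x ^ 2 ∂μ := by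
  have := cs_int μ (f := f) (h := fun x => |h x|) (cint μ (hf.pow 2)) (by simpa using h2)
    (cint_mul μ hf hh.abs)
  simpa using this

/-- Reduction of the Hessian to the covariance form. -/
lemma hess_reduce (lam : Fin d → ℝ) (i0 : Fin d) (l : ℝ) (H : Hyp lam i0 l) :
    ∃ C : ℝ, 0 < C ∧ ∀ σ : ℝ, (σ = 1 ∨ σ = -1) → ∀ μ : Measure (Sph d), IsProbabilityMeasure μ →
      ∀ h : Sph d → ℝ, Integrable h μ → Integrable (fun x => h x ^ 2) μ → ∫ x, h x ∂μ = 0 →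
      ∀ δ : ℝ, 0 < δ →
      ∫ x, ∫ y, Kker lam x y * h x * h y ∂μ ∂μ ≤
        Real.exp (lam i0) * ∑ i ∈ Finset.univ.erase i0, lam i * (∫ x, x.1 i * h x ∂μ) ^ 2 +
        C * (δ * ∫ x, al i0 σ x ^ 2 ∂μ + δ⁻¹ * ∫ x, al i0 σ x ^ 4 ∂μ) * ∫ x, h x ^ 2 ∂μ := by
  obtain ⟨C, hC, hK⟩ := Kker_second lam i0 l H
  refine ⟨Real.exp (lam i0) * C * 4, by positivity, ?_⟩
  intro σ hσ μ hμ h hh h2 h0 δ hδ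
  have ca := cont_al i0 σ
  set g : Sph d → ℝ := fun x => Real.exp (-lam i0 * al i0 σ x ^ 2) with hg
  have cg : Continuous g := by rw [hg]; fun_prop
  set E := Real.exp (lam i0) with hE
  have hEpos : 0 < E := Real.exp_pos _
  -- integrals of the pieces
  have hgh := cint_mul μ cg hh
  have i1 : Integrable (fun z : Sph d × Sph d => (g z.1 * h z.1) * h z.2) (μ.prod μ) :=
    hgh.mul_prod hh
  have i2 : Integrable (fun z : Sph d × Sph d => h z.1 * (g z.2 * h z.2)) (μ.prod μ) :=
    hh.mul_prod hgh
  have i3 : Integrable (fun z : Sph d × Sph d => h z.1 * h z.2) (μ.prod μ) := hh.mul_prod hh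
  have cQ : Continuous (fun z : Sph d × Sph d => Qp lam i0 z.1 z.2) := by
    unfold Qp; fun_prop
  have i4 := kint μ cQ hh hh
  have ha3 := cint_mul μ (ca.pow 3) hh.abs
  have ha1 := cint_mul μ ca hh.abs
  have i5 : Integrable (fun z : Sph d × Sph d => (al i0 σ z.1 ^ 3 * |h z.1|) *
    (al i0 σ z.2 * |h z.2|)) (μ.prod μ) := ha3.mul_prod ha1
  have i6 : Integrable (fun z : Sph d × Sph d => (al i0 σ z.1 * |h z.1|) *
    (al i0 σ z.2 ^ 3 * |h z.2|)) (μ.prod μ) := ha1.mul_prod ha3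
  have e1 : ∫ z : Sph d × Sph d, (g z.1 * h z.1) * h z.2 ∂(μ.prod μ) = 0 := by
    rw [integral_prod_mul (fun x => g x * h x) h, h0, mul_zero]
  have e2 : ∫ z : Sph d × Sph d, h z.1 * (g z.2 * h z.2) ∂(μ.prod μ) = 0 := by
    rw [integral_prod_mul h (fun x => g x * h x), h0, zero_mul]
  have e3 : ∫ z : Sph d × Sph d, h z.1 * h z.2 ∂(μ.prod μ) = 0 := by
    rw [integral_prod_mul h h, h0, zero_mul]
  have e5 := integral_prod_mul (μ := μ) (ν := μ) (fun x => al i0 σ x ^ 3 * |h x|)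
    (fun x => al i0 σ x * |h x|)
  have e6 := integral_prod_mul (μ := μ) (ν := μ) (fun x => al i0 σ x * |h x|)
    (fun x => al i0 σ x ^ 3 * |h x|)
  rw [hess_prod lam μ hh]
  have hle : ∫ z : Sph d × Sph d, Kker lam z.1 z.2 * (h z.1 * h z.2) ∂(μ.prod μ) ≤
      ∫ z : Sph d × Sph d, (E * ((g z.1 * h z.1) * h z.2 + h z.1 * (g z.2 * h z.2)
        - h z.1 * h z.2 + Qp lam i0 z.1 z.2 * (h z.1 * h z.2)) +
        E * C * ((al i0 σ z.1 ^ 3 * |h z.1|) * (al i0 σ z.2 * |h z.2|) +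
         (al i0 σ z.1 * |h z.1|) * (al i0 σ z.2 ^ 3 * |h z.2|))) ∂(μ.prod μ) := by
    apply integral_mono (kint μ (cont_K lam) hh hh)
      ((((i1.add i2).sub i3).add i4).const_mul E |>.add ((i5.add i6).const_mul (E * C)))
    intro z
    have hk := hK σ hσ z.1 z.2
    set R := Kker lam z.1 z.2 / E - (g z.1 + g z.2 - 1) - Qp lam i0 z.1 z.2 with hR
    have hKe : Kker lam z.1 z.2 = E * (g z.1 + g z.2 - 1 + Qp lam i0 z.1 z.2 + R) := by
      rw [hR]; field_simp; ring
    have hRh : R * (h z.1 * h z.2) ≤ C * ((al i0 σ z.1 ^ 2 + al i0 σ z.2 ^ 2) *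
        (al i0 σ z.1 * al i0 σ z.2)) * (|h z.1| * |h z.2|) := by
      refine (le_abs_self _).trans ?_
      rw [abs_mul, abs_mul]
      gcongr
    simp only [Pi.add_apply, Pi.sub_apply]
    rw [hKe]
    have := mul_le_mul_of_nonneg_left hRh hEpos.le
    calc E * (g z.1 + g z.2 - 1 + Qp lam i0 z.1 z.2 + R) * (h z.1 * h z.2)
        = E * ((g z.1 * h z.1) * h z.2 + h z.1 * (g z.2 * h z.2)
        - h z.1 * h z.2 + Qp lam i0 z.1 z.2 * (h z.1 * h z.2)) + E * (R * (h z.1 * h z.2)) := by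
          ring
      _ ≤ E * ((g z.1 * h z.1) * h z.2 + h z.1 * (g z.2 * h z.2)
        - h z.1 * h z.2 + Qp lam i0 z.1 z.2 * (h z.1 * h z.2)) +
          E * (C * ((al i0 σ z.1 ^ 2 + al i0 σ z.2 ^ 2) *
        (al i0 σ z.1 * al i0 σ z.2)) * (|h z.1| * |h z.2|)) := by linarith
      _ = _ := by ring
  refine hle.trans ?_
  have j1 := i1.fun_add i2
  have j2 : Integrable (fun z : Sph d × Sph d => (g z.1 * h z.1) * h z.2 +
    h z.1 * (g z.2 * h z.2) - h z.1 * h z.2) (μ.prod μ) := j1.sub i3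
  have j3 := j2.fun_add i4
  have j4 := i5.fun_add i6
  rw [integral_add (j3.const_mul E) (j4.const_mul (E * C)),
    integral_const_mul, integral_const_mul, integral_add i5 i6,
    integral_add j2 i4, integral_sub j1 i3, integral_add i1 i2,
    e1, e2, e3, e5, e6, integral_coord_sum lam i0 μ hh]
  have c3 := cs_h μ (f := fun x => al i0 σ x ^ 3) (ca.pow 3) hh h2
  have c1 := cs_h μ ca hh h2
  have h6 : ∫ x, (al i0 σ x ^ 3) ^ 2 ∂μ ≤ 2 * ∫ x, al i0 σ x ^ 4 ∂μ := by
    rw [← integral_const_mul]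
    apply integral_mono (cint μ ((ca.pow 3).pow 2)) ((cint μ (ca.pow 4)).const_mul 2)
    intro x
    have := defect_le i0 hσ x
    rw [← al_sq i0 hσ] at this
    show (al i0 σ x ^ 3) ^ 2 ≤ 2 * al i0 σ x ^ 4
    have h4 : 0 ≤ al i0 σ x ^ 4 := pow_nonneg (al_nonneg i0 σ x) 4
    nlinarith
  set u := ∫ x, al i0 σ x ^ 3 * |h x| ∂μ
  set v := ∫ x, al i0 σ x * |h x| ∂μ
  set N := ∫ x, h x ^ 2 ∂μ with hN
  have hN0 : 0 ≤ N := integral_nonneg fun x => sq_nonneg _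
  have c3' : u ^ 2 ≤ 2 * (∫ x, al i0 σ x ^ 4 ∂μ) * N := c3.trans (by gcongr)
  have young : u * v + v * u ≤ δ⁻¹ * u ^ 2 + δ * v ^ 2 := by
    have : 0 ≤ δ⁻¹ * (u - δ * v) ^ 2 := by positivity
    have e : δ⁻¹ * (u - δ * v) ^ 2 = δ⁻¹ * u ^ 2 + δ * v ^ 2 - 2 * (u * v) := by
      field_simp; ring
    linarith
  have fin : u * v + v * u ≤ 4 * ((δ * ∫ x, al i0 σ x ^ 2 ∂μ) + δ⁻¹ * ∫ x, al i0 σ x ^ 4 ∂μ) * N := by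
    have w1 := mul_le_mul_of_nonneg_left c3' (inv_pos.2 hδ).le
    have w2 := mul_le_mul_of_nonneg_left c1 hδ.le
    have p1 : 0 ≤ δ * (∫ x, al i0 σ x ^ 2 ∂μ) * N := by
      have : 0 ≤ ∫ x, al i0 σ x ^ 2 ∂μ := integral_nonneg fun x => sq_nonneg _
      positivity
    have p2 : 0 ≤ δ⁻¹ * (∫ x, al i0 σ x ^ 4 ∂μ) * N := by
      have : 0 ≤ ∫ x, al i0 σ x ^ 4 ∂μ := integral_nonneg fun x => pow_nonneg (al_nonneg i0 σ x) 4
      positivity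
    linarith
  have := mul_le_mul_of_nonneg_left fin (mul_nonneg hEpos.le hC.le)
  linarith

/-- Bound of the covariance form. -/
lemma cov_form (lam : Fin d → ℝ) (i0 : Fin d) (l : ℝ) (H : Hyp lam i0 l)
    (μ : Measure (Sph d)) [IsProbabilityMeasure μ] (ε M : ℝ) (hε : 0 < ε) (hM : 0 ≤ M)
    (hcov : ∀ i, i ≠ i0 → ∀ j, j ≠ i0 →
      Real.exp (lam i0) * lam i0 * (∫ x, (x.1 j - ∫ z, z.1 j ∂μ) * (x.1 i - ∫ z, z.1 i ∂μ) ∂μ) ≤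
        (if i = j then ε else 0) + M ∧
      (i ≠ j → -M ≤ Real.exp (lam i0) * lam i0 *
        (∫ x, (x.1 j - ∫ z, z.1 j ∂μ) * (x.1 i - ∫ z, z.1 i ∂μ) ∂μ)))
    (h : Sph d → ℝ) (hh : Integrable h μ) (h2 : Integrable (fun x => h x ^ 2) μ)
    (h0 : ∫ x, h x ∂μ = 0) :
    Real.exp (lam i0) * ∑ i ∈ Finset.univ.erase i0, lam i * (∫ x, x.1 i * h x ∂μ) ^ 2 ≤
      (ε * (l / lam i0) + d * M) * ∫ x, h x ^ 2 ∂μ := by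
  have hL := H.2.2.1 i0
  set m : Fin d → ℝ := fun i => ∫ z, z.1 i ∂μ with hm
  set b : Fin d → ℝ := fun i => ∫ x, x.1 i * h x ∂μ with hb
  set S := Finset.univ.erase i0 with hS
  set E := Real.exp (lam i0) with hE
  have hEpos : 0 < E := Real.exp_pos _
  set N := ∫ x, h x ^ 2 ∂μ with hN
  have hN0 : 0 ≤ N := integral_nonneg fun x => sq_nonneg _
  set T := ∑ i ∈ S, lam i * b i ^ 2 with hT
  have hT0 : 0 ≤ T := Finset.sum_nonneg fun i _ => mul_nonneg (H.2.2.1 i).le (sq_nonneg _)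
  set f : Sph d → ℝ := fun x => ∑ i ∈ S, lam i * b i * (x.1 i - m i) with hf
  have cf : Continuous f := by rw [hf]; fun_prop
  have hfh : ∫ x, f x * h x ∂μ = T := by
    have e : (fun x => f x * h x) = fun x => ∑ i ∈ S, lam i * b i * (x.1 i * h x - m i * h x) := by
      funext x
      rw [hf]; simp only
      rw [Finset.sum_mul]
      apply Finset.sum_congr rfl
      intro i _; ring
    rw [e, integral_finsetSum]
    · apply Finset.sum_congr rfl
      intro i _
      rw [integral_const_mul, integral_sub (cint_mul μ (cont_coord i) hh) (hh.const_mul _),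
        integral_const_mul, h0]
      rw [hb]; simp only; ring
    · intro i _
      exact ((cint_mul μ (cont_coord i) hh).sub (hh.const_mul _)).const_mul _
  have hff : ∫ x, f x ^ 2 ∂μ = ∑ i ∈ S, ∑ j ∈ S, lam i * b i * (lam j * b j) *
      ∫ x, (x.1 j - m j) * (x.1 i - m i) ∂μ := by
    have e : (fun x => f x ^ 2) = fun x => ∑ i ∈ S, ∑ j ∈ S, lam i * b i * (lam j * b j) *
      ((x.1 j - m j) * (x.1 i - m i)) := by
      funext x
      rw [hf]; simp only
      rw [sq, Finset.sum_mul_sum]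
      apply Finset.sum_congr rfl
      intro i _
      apply Finset.sum_congr rfl
      intro j _; ring
    rw [e, integral_finsetSum]
    · apply Finset.sum_congr rfl
      intro i _
      rw [integral_finsetSum]
      · apply Finset.sum_congr rfl
        intro j _
        rw [integral_const_mul]
      · intro j _
        exact cint μ (by fun_prop)
    · intro i _
      exact cint μ (by fun_prop)
  have hcs := cs_int μ (cint μ (cf.pow 2)) h2 (cint_mul μ cf hh)
  rw [hfh] at hcs
  have hffb : E * lam i0 * ∫ x, f x ^ 2 ∂μ ≤ ε * l * T + M * (∑ i ∈ S, lam i * |b i|) ^ 2 := by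
    rw [hff, Finset.mul_sum]
    have : ∀ i ∈ S, E * lam i0 * ∑ j ∈ S, lam i * b i * (lam j * b j) *
        ∫ x, (x.1 j - m j) * (x.1 i - m i) ∂μ ≤
        ε * l * (lam i * b i ^ 2) + M * (lam i * |b i|) * ∑ j ∈ S, lam j * |b j| := by
      intro i hi
      have hi' := (Finset.mem_erase.1 hi).1
      have h3 : ∀ j ∈ S, E * lam i0 * (lam i * b i * (lam j * b j) *
        ∫ x, (x.1 j - m j) * (x.1 i - m i) ∂μ) ≤
          (if i = j then ε * l * (lam i * b i ^ 2) else 0) +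
            M * (lam i * |b i|) * (lam j * |b j|) := by
        intro j hj
        have hj' := (Finset.mem_erase.1 hj).1
        obtain ⟨k1, k2⟩ := hcov i hi' j hj'
        set c := E * lam i0 * ∫ x, (x.1 j - m j) * (x.1 i - m i) ∂μ with hc
        have e : E * lam i0 * (lam i * b i * (lam j * b j) *
          ∫ x, (x.1 j - m j) * (x.1 i - m i) ∂μ) = (lam i * b i * (lam j * b j)) * c := by
          rw [hc]; ring
        rw [e]
        have li := H.2.2.1 i
        have lj := H.2.2.1 j
        have lil := H.2.2.2 i hi'
        by_cases hij : i = j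
        · subst hij
          simp only [if_true] at k1 ⊢
          have q1 : lam i * b i * (lam i * b i) * c ≤ lam i * b i * (lam i * b i) * (ε + M) := by
            apply mul_le_mul_of_nonneg_left k1 (mul_self_nonneg _)
          have q2 : M * (lam i * |b i|) * (lam i * |b i|) = M * (lam i * b i * (lam i * b i)) := by
            have := abs_mul_abs_self (b i)
            calc _ = M * (lam i * lam i) * (|b i| * |b i|) := by ring
              _ = _ := by rw [this]; ring
          have q3 : lam i * b i * (lam i * b i) * ε ≤ ε * l * (lam i * b i ^ 2) := by
            have : 0 ≤ ε * (lam i * b i ^ 2) := by positivity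
            nlinarith
          rw [q2]; linarith
        · simp only [hij, if_false, zero_add] at k1 ⊢
          have hcM : |c| ≤ M := abs_le.2 ⟨k2 hij, k1⟩
          refine (le_abs_self _).trans ?_
          rw [abs_mul, abs_mul, abs_mul, abs_mul, abs_of_pos li, abs_of_pos lj]
          calc lam i * |b i| * (lam j * |b j|) * |c| ≤ lam i * |b i| * (lam j * |b j|) * M := by
                gcongr
            _ = _ := by ring
      rw [Finset.mul_sum]
      refine (Finset.sum_le_sum h3).trans ?_
      rw [Finset.sum_add_distrib, Finset.sum_ite_eq, if_pos hi, ← Finset.mul_sum]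
    refine (Finset.sum_le_sum this).trans ?_
    rw [Finset.sum_add_distrib, ← Finset.mul_sum, ← Finset.sum_mul, ← Finset.mul_sum]
    apply le_of_eq; rw [hT]; ring
  have hsq : (∑ i ∈ S, lam i * |b i|) ^ 2 ≤ d * (lam i0 * T) := by
    refine (sq_sum_le_card_mul_sum_sq).trans ?_
    have hc : (S.card : ℝ) ≤ d := by
      have := Finset.card_erase_le (s := (Finset.univ : Finset (Fin d))) (a := i0)
      simp only [Finset.card_univ, Fintype.card_fin] at this
      exact_mod_cast this
    have : ∑ i ∈ S, (lam i * |b i|) ^ 2 ≤ lam i0 * T := by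
      rw [hT, Finset.mul_sum]
      apply Finset.sum_le_sum
      intro i _
      rw [mul_pow, sq_abs]
      have := lam_le H i
      have := H.2.2.1 i
      have : 0 ≤ lam i * b i ^ 2 := by positivity
      nlinarith
    gcongr
  have hX : E * lam i0 * T ^ 2 ≤ (ε * l + d * lam i0 * M) * T * N := by
    have w1 : E * lam i0 * T ^ 2 ≤ E * lam i0 * ((∫ x, f x ^ 2 ∂μ) * N) := by gcongr
    have w2 := mul_le_mul_of_nonneg_right hffb hN0
    have w3 : M * (∑ i ∈ S, lam i * |b i|) ^ 2 * N ≤ M * (d * (lam i0 * T)) * N := by gcongr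
    linarith
  have hfin : E * lam i0 * T ≤ (ε * l + d * lam i0 * M) * N := by
    rcases hT0.eq_or_lt with h | h
    · rw [← h, mul_zero]
      have := H.1
      positivity
    · refine le_of_mul_le_mul_right ?_ h
      linarith
  have e : (ε * (l / lam i0) + d * M) * N = ((ε * l + d * lam i0 * M) * N) / lam i0 := by
    field_simp
  rw [e, le_div_iff₀ hL]
  linarith

lemma cont_sphMap (g : EuclideanSpace ℝ (Fin d) ≃ₗᵢ[ℝ] EuclideanSpace ℝ (Fin d)) :
    Continuous (sphMap g) := by
  unfold sphMap
  exact Continuous.subtype_mk (g.continuous.comp continuous_subtype_val) _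

lemma open_pos {ω : Measure (Sph d)} (hω : IsUniform ω) {U : Set (Sph d)} (hU : IsOpen U)
    (hne : U.Nonempty) : 0 < ω U := by
  by_contra hcon
  have h0 : ω U = 0 := by simpa using hcon
  obtain ⟨u, hu⟩ := hne
  have := hω.1
  have hz : ω Set.univ = 0 := by
    apply isCompact_univ.measure_zero_of_nhdsWithin
    intro x _
    have hn : ‖(x : EuclideanSpace ℝ (Fin d))‖ = ‖(u : EuclideanSpace ℝ (Fin d))‖ := by
      rw [mem_sphere_zero_iff_norm.1 x.2, mem_sphere_zero_iff_norm.1 u.2]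
    set g := (ℝ ∙ ((x : EuclideanSpace ℝ (Fin d)) - u))ᗮ.reflection with hg
    have hgx : sphMap g x = u := Subtype.ext (Submodule.reflection_sub hn)
    refine ⟨sphMap g ⁻¹' U, ?_, ?_⟩
    · apply mem_nhdsWithin_of_mem_nhds
      apply (hU.preimage (cont_sphMap g)).mem_nhds
      rw [Set.mem_preimage, hgx]; exact hu
    · have h1 := hω.2 g
      have h2 := Measure.map_apply (μ := ω) (cont_sphMap g).measurable hU.measurableSet
      rw [h1] at h2
      rw [← h2, h0]
  simp at hz

/-- the point `σ e₁` on the sphere -/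
def pole (i0 : Fin d) (σ : ℝ) (hσ : σ = 1 ∨ σ = -1) : Sph d :=
  ⟨EuclideanSpace.single i0 σ, by
    rw [mem_sphere_zero_iff_norm, PiLp.norm_single]
    rcases hσ with rfl | rfl <;> simp⟩

lemma al_pole (i0 : Fin d) {σ : ℝ} (hσ : σ = 1 ∨ σ = -1) : al i0 σ (pole i0 σ hσ) = 0 := by
  unfold al pole
  rcases hσ with rfl | rfl <;> simp

lemma cap_pos {ω : Measure (Sph d)} (hω : IsUniform ω) (i0 : Fin d) {σ : ℝ}
    (hσ : σ = 1 ∨ σ = -1) {r : ℝ} (hr : 0 < r) : 0 < ω {x | al i0 σ x < r} := by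
  apply open_pos hω
  · exact isOpen_lt (cont_al i0 σ) continuous_const
  · exact ⟨pole i0 σ hσ, by simpa [al_pole] using hr⟩

/-- measure with real density -/
def dm (ω : Measure (Sph d)) (ρ : Sph d → ℝ) : Measure (Sph d) :=
  ω.withDensity (fun x => ENNReal.ofReal (ρ x))

/-- probability densities with finite entropy -/
def Dens (ω : Measure (Sph d)) (ρ : Sph d → ℝ) : Prop :=
  Measurable ρ ∧ (∀ x, 0 ≤ ρ x) ∧ Integrable ρ ω ∧
    Integrable (fun x => ρ x * Real.log (ρ x)) ω ∧ ∫ x, ρ x ∂ω = 1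

lemma dm_prob {ω : Measure (Sph d)} {ρ : Sph d → ℝ} (h : Dens ω ρ) :
    IsProbabilityMeasure (dm ω ρ) := by
  constructor
  unfold dm
  rw [withDensity_apply _ MeasurableSet.univ, Measure.restrict_univ,
    ← ofReal_integral_eq_lintegral_ofReal h.2.2.1 (Eventually.of_forall h.2.1), h.2.2.2.2]
  simp

lemma integral_dm {ω : Measure (Sph d)} {ρ : Sph d → ℝ} (hm : Measurable ρ) (h0 : ∀ x, 0 ≤ ρ x)
    (F : Sph d → ℝ) : ∫ x, F x ∂(dm ω ρ) = ∫ x, ρ x * F x ∂ω := by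
  unfold dm
  rw [integral_withDensity_eq_integral_toReal_smul hm.ennreal_ofReal
    (Eventually.of_forall fun x => ENNReal.ofReal_lt_top)]
  apply integral_congr_ae
  refine Eventually.of_forall fun x => ?_
  simp only [smul_eq_mul]
  rw [ENNReal.toReal_ofReal (h0 x)]

lemma ent_dm {ω : Measure (Sph d)} [IsProbabilityMeasure ω] {ρ : Sph d → ℝ} (h : Dens ω ρ) :
    Ent ω (dm ω ρ) = ((∫ x, ρ x * Real.log (ρ x) ∂ω : ℝ) : EReal) := by
  have hac : dm ω ρ ≪ ω := withDensity_absolutelyContinuous _ _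
  have hrn : (dm ω ρ).rnDeriv ω =ᵐ[ω] fun x => ENNReal.ofReal (ρ x) :=
    Measure.rnDeriv_withDensity ω h.1.ennreal_ofReal
  have hae : (fun x => Real.log ((dm ω ρ).rnDeriv ω x).toReal) =ᵐ[dm ω ρ]
      fun x => Real.log (ρ x) := by
    filter_upwards [hac.ae_le hrn] with x hx
    rw [hx, ENNReal.toReal_ofReal (h.2.1 x)]
  have hlogi : Integrable (fun x => Real.log (ρ x)) (dm ω ρ) := by
    unfold dm
    rw [integrable_withDensity_iff_integrable_smul' h.1.ennreal_ofReal
      (Eventually.of_forall fun x => ENNReal.ofReal_lt_top)]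
    refine h.2.2.2.1.congr (Eventually.of_forall fun x => ?_)
    simp only [smul_eq_mul]
    rw [ENNReal.toReal_ofReal (h.2.1 x)]
  unfold Ent
  rw [if_pos ⟨hac, hlogi.congr hae.symm⟩, integral_congr_ae hae, integral_dm h.1 h.2.1]

lemma dens_of_ent {ω μ : Measure (Sph d)} [IsProbabilityMeasure ω] [IsProbabilityMeasure μ]
    (h : Ent ω μ ≠ ⊤) : ∃ ρ, Dens ω ρ ∧ μ = dm ω ρ := by
  unfold Ent at h
  split_ifs at h with hc
  · obtain ⟨hac, hlogi⟩ := hc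
    set ρ : Sph d → ℝ := fun x => (μ.rnDeriv ω x).toReal with hρ
    have hm : Measurable ρ := (Measure.measurable_rnDeriv μ ω).ennreal_toReal
    have h0 : ∀ x, 0 ≤ ρ x := fun x => ENNReal.toReal_nonneg
    have heq : μ = dm ω ρ := by
      have h8 : μ.HaveLebesgueDecomposition ω :=
        Measure.haveLebesgueDecomposition_of_sigmaFinite μ ω
      have h9 := Measure.withDensity_rnDeriv_eq μ ω hac
      refine h9.symm.trans ?_
      unfold dm
      apply withDensity_congr_ae
      filter_upwards [Measure.rnDeriv_lt_top μ ω] with x hx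
      rw [hρ]; simp only
      rw [ENNReal.ofReal_toReal hx.ne]
    refine ⟨ρ, ⟨hm, h0, Measure.integrable_toReal_rnDeriv, ?_, ?_⟩, heq⟩
    · have h3 := hlogi
      rw [heq] at h3
      have hrn : (dm ω ρ).rnDeriv ω = μ.rnDeriv ω := by rw [← heq]
      unfold dm at h3
      rw [integrable_withDensity_iff_integrable_smul' hm.ennreal_ofReal
        (Eventually.of_forall fun x => ENNReal.ofReal_lt_top)] at h3
      refine h3.congr (Eventually.of_forall fun x => ?_)
      simp only [smul_eq_mul]
      rw [ENNReal.toReal_ofReal (h0 x)]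
      have : (ω.withDensity fun x => ENNReal.ofReal (ρ x)).rnDeriv ω = μ.rnDeriv ω := hrn
      rw [this]
    · rw [hρ, Measure.integral_toReal_rnDeriv hac]
      simp
  · exact absurd rfl h

/-- symmetric bilinear interaction form on densities -/
def Bil (lam : Fin d → ℝ) (ω : Measure (Sph d)) (f g : Sph d → ℝ) : ℝ :=
  ∫ z : Sph d × Sph d, Kker lam z.1 z.2 * (f z.1 * g z.2) ∂(ω.prod ω)

lemma Bil_symm (lam : Fin d → ℝ) (ω : Measure (Sph d)) [IsProbabilityMeasure ω]
    (f g : Sph d → ℝ) : Bil lam ω f g = Bil lam ω g f := by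
  unfold Bil
  rw [← integral_prod_swap]
  apply integral_congr_ae
  refine Eventually.of_forall fun z => ?_
  simp only [Prod.fst_swap, Prod.snd_swap]
  rw [K_symm lam z.2 z.1]; ring

lemma Bil_add_left (lam : Fin d → ℝ) (ω : Measure (Sph d)) [IsProbabilityMeasure ω]
    {f1 f2 g : Sph d → ℝ} (a b : ℝ) (h1 : Integrable f1 ω) (h2 : Integrable f2 ω)
    (hg : Integrable g ω) :
    Bil lam ω (fun x => a * f1 x + b * f2 x) g = a * Bil lam ω f1 g + b * Bil lam ω f2 g := by
  unfold Bil
  rw [← integral_const_mul, ← integral_const_mul,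
    ← integral_add ((kint ω (cont_K lam) h1 hg).const_mul a)
      ((kint ω (cont_K lam) h2 hg).const_mul b)]
  apply integral_congr_ae
  refine Eventually.of_forall fun z => ?_
  simp only; ring

lemma Bil_eq (lam : Fin d → ℝ) (ω : Measure (Sph d)) [IsProbabilityMeasure ω]
    {f ρ : Sph d → ℝ} (hf : Integrable f ω) (hρ : Dens ω ρ) :
    Bil lam ω f ρ = ∫ x, f x * WA lam (dm ω ρ) x ∂ω := by
  unfold Bil
  rw [integral_prod _ (kint ω (cont_K lam) hf hρ.2.2.1)]
  apply integral_congr_ae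
  refine Eventually.of_forall fun x => ?_
  simp only
  unfold WA
  rw [integral_dm hρ.1 hρ.2.1, ← integral_const_mul]
  apply integral_congr_ae
  refine Eventually.of_forall fun y => ?_
  simp only; ring

lemma IA_dm (lam : Fin d → ℝ) (ω : Measure (Sph d)) [IsProbabilityMeasure ω]
    {ρ : Sph d → ℝ} (hρ : Dens ω ρ) : IA lam (dm ω ρ) = Bil lam ω ρ ρ := by
  rw [Bil_eq lam ω hρ.2.2.1 hρ, ← integral_dm hρ.1 hρ.2.1]
  rfl

/-- entropy of a density -/
def Hn (ω : Measure (Sph d)) (ρ : Sph d → ℝ) : ℝ := ∫ x, ρ x * Real.log (ρ x) ∂ω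

lemma EA_dm (lam : Fin d → ℝ) (ω : Measure (Sph d)) [IsProbabilityMeasure ω] (ε : ℝ)
    {ρ : Sph d → ℝ} (hρ : Dens ω ρ) :
    EA lam ω ε (dm ω ρ) = ((ε * Hn ω ρ - Bil lam ω ρ ρ / 2 : ℝ) : EReal) := by
  unfold EA
  rw [ent_dm hρ, IA_dm lam ω hρ]
  unfold Hn
  push_cast
  rfl

lemma dens_one (ω : Measure (Sph d)) [IsProbabilityMeasure ω] : Dens ω (fun _ => 1) := by
  refine ⟨measurable_const, fun _ => zero_le_one, integrable_const _, by simp, by simp⟩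

/-- minimizers have densities, and minimality expressed with densities -/
lemma min_dens {lam : Fin d → ℝ} {ω : Measure (Sph d)} [IsProbabilityMeasure ω] {ε : ℝ}
    (hε : 0 < ε) {μ : Measure (Sph d)} (hμ : IsMinimizer lam ω ε μ) :
    ∃ ρ, Dens ω ρ ∧ μ = dm ω ρ ∧ ∀ ρ', Dens ω ρ' →
      ε * Hn ω ρ - Bil lam ω ρ ρ / 2 ≤ ε * Hn ω ρ' - Bil lam ω ρ' ρ' / 2 := by
  have := hμ.1
  have hne : Ent ω μ ≠ ⊤ := by
    intro htop
    have h1 := hμ.2 _ (dm_prob (dens_one ω))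
    rw [EA_dm lam ω ε (dens_one ω)] at h1
    unfold EA at h1
    rw [htop, EReal.coe_mul_top_of_pos hε, EReal.top_sub_coe] at h1
    exact absurd h1 (not_le.2 (EReal.coe_lt_top _))
  obtain ⟨ρ, hρ, rfl⟩ := dens_of_ent hne
  refine ⟨ρ, hρ, rfl, fun ρ' hρ' => ?_⟩
  have h1 := hμ.2 _ (dm_prob hρ')
  rw [EA_dm lam ω ε hρ', EA_dm lam ω ε hρ] at h1
  exact EReal.coe_le_coe_iff.1 h1

lemma mul_log_ge (u : ℝ) (hu : 0 ≤ u) : u - 1 ≤ u * Real.log u := by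
  have := InformationTheory.klFun_nonneg hu
  unfold InformationTheory.klFun at this
  linarith

lemma Hn_nonneg {ω : Measure (Sph d)} [IsProbabilityMeasure ω] {ρ : Sph d → ℝ}
    (h : Dens ω ρ) : 0 ≤ Hn ω ρ := by
  have h1 : ∫ x, (ρ x - 1) ∂ω ≤ Hn ω ρ := by
    apply integral_mono (h.2.2.1.sub (integrable_const _)) h.2.2.2.1
    intro x
    exact mul_log_ge _ (h.2.1 x)
  rw [integral_sub h.2.2.1 (integrable_const _), h.2.2.2.2] at h1
  simpa using h1

lemma dens_mix {ω : Measure (Sph d)} [IsProbabilityMeasure ω] {ρ g : Sph d → ℝ}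
    (h : Dens ω ρ) (hg : Dens ω g) {t : ℝ} (ht0 : 0 ≤ t) (ht1 : t ≤ 1) :
    Dens ω (fun x => (1 - t) * ρ x + t * g x) ∧
      Hn ω (fun x => (1 - t) * ρ x + t * g x) ≤ (1 - t) * Hn ω ρ + t * Hn ω g := by
  have hm : Measurable (fun x => (1 - t) * ρ x + t * g x) :=
    (h.1.const_mul _).add (hg.1.const_mul _)
  have hi : Integrable (fun x => (1 - t) * ρ x + t * g x) ω :=
    (h.2.2.1.const_mul _).add (hg.2.2.1.const_mul _)
  have hn : ∀ x, 0 ≤ (1 - t) * ρ x + t * g x := fun x =>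
    add_nonneg (mul_nonneg (by linarith) (h.2.1 x)) (mul_nonneg ht0 (hg.2.1 x))
  have hup : Integrable (fun x => (1 - t) * (ρ x * Real.log (ρ x)) + t * (g x * Real.log (g x))) ω :=
    (h.2.2.2.1.const_mul _).add (hg.2.2.2.1.const_mul _)
  have hlo : Integrable (fun x => ((1 - t) * ρ x + t * g x) - 1) ω := hi.sub (integrable_const _)
  have hub : ∀ x, ((1 - t) * ρ x + t * g x) * Real.log ((1 - t) * ρ x + t * g x) ≤
      (1 - t) * (ρ x * Real.log (ρ x)) + t * (g x * Real.log (g x)) := by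
    intro x
    have := Real.convexOn_mul_log.2 (Set.mem_Ici.2 (h.2.1 x)) (Set.mem_Ici.2 (hg.2.1 x))
      (by linarith : (0:ℝ) ≤ 1 - t) ht0 (by ring)
    simpa [smul_eq_mul] using this
  have hent : Integrable (fun x => ((1 - t) * ρ x + t * g x) *
      Real.log ((1 - t) * ρ x + t * g x)) ω := by
    refine Integrable.mono' (hup.abs.add hlo.abs) ?_ ?_
    · exact (hm.mul hm.log).aestronglyMeasurable
    · refine Eventually.of_forall fun x => ?_
      have h1 := hub x
      have h2 := mul_log_ge _ (hn x)
      simp only [Pi.add_apply]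
      rw [Real.norm_eq_abs, abs_le]
      constructor
      · have := neg_abs_le ((1 - t) * ρ x + t * g x - 1)
        have := abs_nonneg ((1 - t) * (ρ x * Real.log (ρ x)) + t * (g x * Real.log (g x)))
        linarith
      · have := le_abs_self ((1 - t) * (ρ x * Real.log (ρ x)) + t * (g x * Real.log (g x)))
        have := abs_nonneg ((1 - t) * ρ x + t * g x - 1)
        linarith
  refine ⟨⟨hm, hn, hi, hent, ?_⟩, ?_⟩
  · rw [integral_add (h.2.2.1.const_mul _) (hg.2.2.1.const_mul _), integral_const_mul,
      integral_const_mul, h.2.2.2.2, hg.2.2.2.2]; ring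
  · unfold Hn
    rw [← integral_const_mul, ← integral_const_mul, ← integral_add (h.2.2.2.1.const_mul _)
      (hg.2.2.2.1.const_mul _)]
    exact integral_mono hent hup hub

lemma cont_WA (lam : Fin d → ℝ) (μ : Measure (Sph d)) [IsProbabilityMeasure μ] :
    Continuous (WA lam μ) := by
  have := continuous_parametric_integral_of_continuous (μ := μ)
    (f := fun x y : Sph d => Kker lam x y) (cont_K lam) (isCompact_univ (X := Sph d))
  simp only [Measure.restrict_univ] at this
  exact this

lemma gibbs_Z_pos (lam : Fin d → ℝ) (ω μ : Measure (Sph d)) [IsProbabilityMeasure ω]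
    [IsProbabilityMeasure μ] (ε : ℝ) : 0 < ∫ z, Real.exp (WA lam μ z / ε) ∂ω := by
  have := cont_WA lam μ
  apply integral_exp_pos
  exact cint ω (by fun_prop)

/-- Minimizers are Gibbs measures. -/
lemma min_gibbs {lam : Fin d → ℝ} {ω : Measure (Sph d)} [IsProbabilityMeasure ω] {ε : ℝ}
    (hε : 0 < ε) {μ : Measure (Sph d)} (hμ : IsMinimizer lam ω ε μ) : IsGibbs lam ω ε μ := by
  have hp := hμ.1
  refine ⟨hp, ?_⟩
  obtain ⟨ρ, hρ, hμρ, hmin⟩ := min_dens hε hμ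
  have cW := cont_WA lam μ
  set Z := ∫ z, Real.exp (WA lam μ z / ε) ∂ω with hZ
  have hZpos : 0 < Z := gibbs_Z_pos lam ω μ ε
  set g : Sph d → ℝ := fun x => Real.exp (WA lam μ x / ε) / Z with hg
  have hgpos : ∀ x, 0 < g x := fun x => div_pos (Real.exp_pos _) hZpos
  have cg : Continuous g := by rw [hg]; fun_prop
  have hlogg : ∀ x, Real.log (g x) = WA lam μ x / ε - Real.log Z := by
    intro x
    rw [hg]; simp only
    rw [Real.log_div (Real.exp_pos _).ne' hZpos.ne', Real.log_exp]
  have hgD : Dens ω g := by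
    refine ⟨cg.measurable, fun x => (hgpos x).le, cint ω cg, ?_, ?_⟩
    · apply cint ω
      exact cg.mul (cg.log fun x => (hgpos x).ne')
    · rw [hg, integral_div, ← hZ, div_self hZpos.ne']
  have hvar : ε * (Hn ω ρ - Hn ω g) - Bil lam ω ρ ρ + Bil lam ω g ρ ≤ 0 := by
    by_contra hcon
    push Not at hcon
    set a := ε * (Hn ω ρ - Hn ω g) - Bil lam ω ρ ρ + Bil lam ω g ρ with ha
    set c := -(Bil lam ω ρ ρ) / 2 + Bil lam ω g ρ - Bil lam ω g g / 2 with hc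
    have key : ∀ t : ℝ, 0 < t → t ≤ 1 → a ≤ t * c := by
      intro t ht0 ht1
      obtain ⟨hD, hH⟩ := dens_mix hρ hgD ht0.le ht1
      have h1 := hmin _ hD
      have hB : Bil lam ω (fun x => (1 - t) * ρ x + t * g x) (fun x => (1 - t) * ρ x + t * g x) =
          (1 - t) ^ 2 * Bil lam ω ρ ρ + 2 * t * (1 - t) * Bil lam ω g ρ + t ^ 2 * Bil lam ω g g := by
        rw [Bil_add_left lam ω _ _ hρ.2.2.1 hgD.2.2.1 hD.2.2.1,
          Bil_symm lam ω ρ, Bil_symm lam ω g,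
          Bil_add_left lam ω _ _ hρ.2.2.1 hgD.2.2.1 hρ.2.2.1,
          Bil_add_left lam ω _ _ hρ.2.2.1 hgD.2.2.1 hgD.2.2.1, Bil_symm lam ω ρ g]
        ring
      rw [hB] at h1
      have h2 := mul_le_mul_of_nonneg_left hH hε.le
      have h3 : t * a ≤ t * (t * c) := by rw [ha, hc]; nlinarith
      exact le_of_mul_le_mul_left h3 ht0
    have hcpos : 0 < c := by
      have := key 1 one_pos le_rfl
      linarith
    have h4 := key (min 1 (a / (2 * c))) (lt_min one_pos (by positivity)) (min_le_left _ _)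
    have h5 : min 1 (a / (2 * c)) * c ≤ a / (2 * c) * c := by
      gcongr; exact min_le_right _ _
    have h6 : a / (2 * c) * c = a / 2 := by field_simp
    linarith
  have iW : Integrable (fun x => g x * WA lam μ x) ω := cint ω (cg.mul cW)
  have iρW : Integrable (fun x => ρ x * WA lam μ x) ω := by
    simpa [mul_comm] using cint_mul ω cW hρ.2.2.1
  have hBg : Bil lam ω g ρ = ∫ x, g x * WA lam μ x ∂ω := by
    rw [Bil_eq lam ω hgD.2.2.1 hρ, ← hμρ]
  have hBρ : Bil lam ω ρ ρ = ∫ x, ρ x * WA lam μ x ∂ω := by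
    rw [Bil_eq lam ω hρ.2.2.1 hρ, ← hμρ]
  have hHg : Hn ω g = (∫ x, g x * WA lam μ x ∂ω) / ε - Real.log Z := by
    unfold Hn
    have e : (fun x => g x * Real.log (g x)) =
        fun x => g x * WA lam μ x / ε - Real.log Z * g x := by
      funext x; rw [hlogg]; ring
    rw [e, integral_sub (iW.div_const ε) (hgD.2.2.1.const_mul _), integral_div,
      integral_const_mul, hgD.2.2.2.2, mul_one]
  have hkl : ∫ x, g x * InformationTheory.klFun (ρ x / g x) ∂ω ≤ 0 ∧
      Integrable (fun x => g x * InformationTheory.klFun (ρ x / g x)) ω := by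
    have e : (fun x => g x * InformationTheory.klFun (ρ x / g x)) = fun x =>
        ρ x * Real.log (ρ x) - ρ x * WA lam μ x / ε + Real.log Z * ρ x + (g x - ρ x) := by
      funext x
      have hgx := hgpos x
      unfold InformationTheory.klFun
      rcases (hρ.2.1 x).eq_or_lt with h | h
      · rw [← h]; simp
      · rw [Real.log_div h.ne' hgx.ne', hlogg]
        field_simp
        ring
    have j1 : Integrable (fun x => ρ x * Real.log (ρ x) - ρ x * WA lam μ x / ε) ω :=
      hρ.2.2.2.1.sub (iρW.div_const ε)
    have j2 := j1.fun_add (hρ.2.2.1.const_mul (Real.log Z))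
    have j3 : Integrable (fun x => g x - ρ x) ω := hgD.2.2.1.sub hρ.2.2.1
    have j4 := j2.fun_add j3
    rw [e]
    refine ⟨?_, j4⟩
    rw [integral_add j2 j3, integral_add j1 (hρ.2.2.1.const_mul (Real.log Z)),
      integral_sub hρ.2.2.2.1 (iρW.div_const ε), integral_sub hgD.2.2.1 hρ.2.2.1, integral_div,
      integral_const_mul, hρ.2.2.2.2, hgD.2.2.2.2, ← hBρ]
    rw [hHg, ← hBg] at hvar
    have h7 : ε * (Hn ω ρ - Bil lam ω ρ ρ / ε + Real.log Z) ≤ 0 := by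
      have : ε * (Hn ω ρ - Bil lam ω ρ ρ / ε + Real.log Z) =
        ε * (Hn ω ρ - (Bil lam ω g ρ / ε - Real.log Z)) - Bil lam ω ρ ρ + Bil lam ω g ρ := by
        field_simp; ring
      rw [this]; exact hvar
    have h8 : Hn ω ρ - Bil lam ω ρ ρ / ε + Real.log Z ≤ 0 := by
      by_contra hcon
      push Not at hcon
      have := mul_pos hε hcon
      linarith
    unfold Hn at h8
    linarith
  have hnn : ∀ x, 0 ≤ g x * InformationTheory.klFun (ρ x / g x) := fun x =>
    mul_nonneg (hgpos x).le (InformationTheory.klFun_nonneg (div_nonneg (hρ.2.1 x) (hgpos x).le))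
  have hz : ∫ x, g x * InformationTheory.klFun (ρ x / g x) ∂ω = 0 :=
    le_antisymm hkl.1 (integral_nonneg hnn)
  have hae := (integral_eq_zero_iff_of_nonneg hnn hkl.2).1 hz
  have hfin : μ = dm ω g := by
    rw [hμρ]
    unfold dm
    apply withDensity_congr_ae
    filter_upwards [hae] with x hx
    have h9 : InformationTheory.klFun (ρ x / g x) = 0 := by
      simpa [(hgpos x).ne'] using hx
    rw [InformationTheory.klFun_eq_zero_iff (div_nonneg (hρ.2.1 x) (hgpos x).le),
      div_eq_one_iff_eq (hgpos x).ne'] at h9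
    rw [h9]
  exact hfin

lemma IA_prod (lam : Fin d → ℝ) (μ : Measure (Sph d)) [IsProbabilityMeasure μ] :
    IA lam μ = ∫ z : Sph d × Sph d, Kker lam z.1 z.2 ∂(μ.prod μ) := by
  rw [integral_prod _ (cint (μ.prod μ) (cont_K lam))]
  rfl

/-- Energy lower bound for minimizers. -/
lemma energy_lb (lam : Fin d → ℝ) (i0 : Fin d) (l : ℝ) (H : Hyp lam i0 l)
    {ω : Measure (Sph d)} (hω : IsUniform ω) {η : ℝ} (hη : 0 < η) :
    ∃ ε0 : ℝ, 0 < ε0 ∧ ∀ ε : ℝ, 0 < ε → ε < ε0 → ∀ μ : Measure (Sph d),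
      IsMinimizer lam ω ε μ → Real.exp (lam i0) - η ≤ IA lam μ := by
  have := hω.1
  obtain ⟨C, hC, hK⟩ := Kker_first lam i0 l H
  set r : ℝ := Real.sqrt (η / (4 * C)) with hr
  have hrpos : 0 < r := Real.sqrt_pos.2 (by positivity)
  have hr2 : r ^ 2 = η / (4 * C) := Real.sq_sqrt (by positivity)
  have hCr : 2 * C * r ^ 2 = η / 2 := by rw [hr2]; field_simp; ring
  set U : Set (Sph d) := {x | al i0 1 x < r} with hU
  have hUm : MeasurableSet U := (isOpen_lt (cont_al i0 1) continuous_const).measurableSet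
  have hUpos : 0 < ω U := cap_pos hω i0 (Or.inl rfl) hrpos
  set a : ℝ := ω.real U with ha
  have hapos : 0 < a := ENNReal.toReal_pos hUpos.ne' (measure_ne_top _ _)
  set f : Sph d → ℝ := U.indicator (fun _ => 1 / a) with hf
  have hfi : Integrable f ω := (integrable_const _).indicator hUm
  have hfl : (fun x => f x * Real.log (f x)) =
      U.indicator (fun _ => 1 / a * Real.log (1 / a)) := by
    funext x
    by_cases hx : x ∈ U <;> simp [hf, hx]
  have hf1 : ∫ x, f x ∂ω = 1 := by
    rw [hf, integral_indicator hUm]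
    simp only [setIntegral_const, smul_eq_mul]
    rw [← ha]; field_simp
  have hfD : Dens ω f := by
    refine ⟨measurable_const.indicator hUm, ?_, hfi, ?_, hf1⟩
    · intro x
      exact Set.indicator_nonneg (fun _ _ => by positivity) x
    · rw [hfl]; exact (integrable_const _).indicator hUm
  have hfH : Hn ω f = -Real.log a := by
    unfold Hn
    rw [hfl, integral_indicator hUm]
    simp only [setIntegral_const, smul_eq_mul]
    rw [← ha, one_div, Real.log_inv]; field_simp
  have hfB : Real.exp (lam i0) - η / 2 ≤ Bil lam ω f f := by
    have e1 : ∫ z : Sph d × Sph d, (Real.exp (lam i0) - η / 2) * (f z.1 * f z.2) ∂(ω.prod ω) =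
        Real.exp (lam i0) - η / 2 := by
      rw [integral_const_mul, integral_prod_mul, hf1]; ring
    rw [← e1]
    unfold Bil
    apply integral_mono ((hfi.mul_prod hfi).const_mul _) (kint ω (cont_K lam) hfi hfi)
    intro z
    simp only
    by_cases h1 : z.1 ∈ U
    · by_cases h2 : z.2 ∈ U
      · apply mul_le_mul_of_nonneg_right _ (mul_nonneg (hfD.2.1 _) (hfD.2.1 _))
        have h3 := (abs_le.1 (hK 1 (Or.inl rfl) z.1 z.2)).1
        have h4 : al i0 1 z.1 ^ 2 ≤ r ^ 2 := pow_le_pow_left₀ (al_nonneg _ _ _) (le_of_lt h1) 2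
        have h5 : al i0 1 z.2 ^ 2 ≤ r ^ 2 := pow_le_pow_left₀ (al_nonneg _ _ _) (le_of_lt h2) 2
        have h6 : C * (al i0 1 z.1 ^ 2 + al i0 1 z.2 ^ 2) ≤ C * (r ^ 2 + r ^ 2) := by gcongr
        linarith
      · simp [hf, h2]
    · simp [hf, h1]
  refine ⟨η / (4 * (|Real.log a| + 1)), by positivity, ?_⟩
  intro ε hε hlt μ hμ
  obtain ⟨ρ, hρ, hμρ, hmin⟩ := min_dens hε hμ
  have h1 := hmin f hfD
  have h2 := mul_nonneg hε.le (Hn_nonneg hρ)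
  rw [hμρ, IA_dm lam ω hρ]
  rw [hfH] at h1
  have h3 : ε * (4 * (|Real.log a| + 1)) ≤ η := ((lt_div_iff₀ (by positivity)).1 hlt).le
  have h4 := mul_le_mul_of_nonneg_left (neg_le_abs (Real.log a)) hε.le
  nlinarith

/-- Concentration near one pole. -/
lemma conc (lam : Fin d → ℝ) (i0 : Fin d) (l : ℝ) (H : Hyp lam i0 l) :
    ∃ C : ℝ, 0 < C ∧ ∀ μ : Measure (Sph d), IsProbabilityMeasure μ → ∀ η : ℝ,
      Real.exp (lam i0) - η ≤ IA lam μ → ∃ σ : ℝ, (σ = 1 ∨ σ = -1) ∧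
        ∫ x, al i0 σ x ^ 2 ∂μ ≤ C * η := by
  have hgap : 0 < lam i0 - l := by linarith [H.2.1]
  refine ⟨Real.exp (lam i0) / (lam i0 - l), by positivity, ?_⟩
  intro μ hp η hη
  set m := ∫ x : Sph d, x.1 i0 ∂μ with hm
  have ci := cint μ (cont_coord i0)
  have h1 : ∫ z : Sph d × Sph d, Real.exp (-lam i0) * ((lam i0 - l) * (1 - z.1.1 i0 * z.2.1 i0))
      ∂(μ.prod μ) ≤ ∫ z : Sph d × Sph d, (Real.exp (lam i0) - Kker lam z.1 z.2) ∂(μ.prod μ) := by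
    have := cont_K lam
    apply integral_mono (cint _ (by fun_prop)) (cint _ (by fun_prop))
    intro z
    exact Kker_gap H z.1 z.2
  rw [integral_sub (integrable_const _) (cint _ (cont_K lam)), ← IA_prod, integral_const_mul,
    integral_const_mul, integral_sub (integrable_const _) (ci.mul_prod ci),
    integral_prod_mul (fun x : Sph d => x.1 i0) (fun x : Sph d => x.1 i0), ← hm] at h1
  simp only [integral_const, probReal_univ, smul_eq_mul, one_mul] at h1
  have h2 : (lam i0 - l) * (1 - m * m) ≤ Real.exp (lam i0) * η := by
    have h3 : Real.exp (lam i0) * Real.exp (-lam i0) = 1 := by rw [← Real.exp_add]; simp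
    have h4 := mul_le_mul_of_nonneg_left (h1.trans (by linarith : _ ≤ η)) (Real.exp_pos (lam i0)).le
    rw [← mul_assoc, h3, one_mul] at h4
    exact h4
  have h5 : 1 - m * m ≤ Real.exp (lam i0) / (lam i0 - l) * η := by
    rw [div_mul_eq_mul_div, le_div_iff₀ hgap]; linarith
  have hsum : ∀ σ : ℝ, (σ = 1 ∨ σ = -1) → ∫ x, al i0 σ x ^ 2 ∂μ = 1 - σ * m := by
    intro σ hσ
    simp only [al_sq i0 hσ]
    rw [integral_sub (integrable_const _) (ci.const_mul σ), integral_const_mul]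
    simp [hm]
  have hm1 : |m| ≤ 1 := by
    have := norm_integral_le_of_norm_le_const (μ := μ) (f := fun x : Sph d => x.1 i0) (C := 1)
      (Eventually.of_forall fun x => by rw [Real.norm_eq_abs]; exact coord_abs_le x i0)
    simpa [hm] using this
  have hm2 := abs_le.1 hm1
  rcases le_total 0 m with h | h
  · refine ⟨1, Or.inl rfl, ?_⟩
    rw [hsum 1 (Or.inl rfl)]
    nlinarith [hm2.1, hm2.2]
  · refine ⟨-1, Or.inr rfl, ?_⟩
    rw [hsum (-1) (Or.inr rfl)]
    nlinarith [hm2.1, hm2.2]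

lemma int_sq_le (μ : Measure (Sph d)) [IsProbabilityMeasure μ] {f : Sph d → ℝ}
    (hf : Continuous f) : (∫ x, f x ∂μ) ^ 2 ≤ ∫ x, f x ^ 2 ∂μ := by
  set m := ∫ x, f x ∂μ with hm
  have h : 0 ≤ ∫ x, (f x - m) ^ 2 ∂μ := integral_nonneg fun x => sq_nonneg _
  have e : (fun x => (f x - m) ^ 2) = fun x => (f x ^ 2 - 2 * m * f x) + m ^ 2 := by
    funext x; ring
  rw [e, integral_add (cint μ (by fun_prop)) (integrable_const _),
    integral_sub (cint μ (by fun_prop)) (cint μ (by fun_prop)), integral_const_mul, ← hm] at h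
  simp at h
  nlinarith

/-- Tail estimate for Gibbs measures. -/
lemma tail (lam : Fin d → ℝ) (i0 : Fin d) (l : ℝ) (H : Hyp lam i0 l)
    {ω : Measure (Sph d)} (hω : IsUniform ω) {r : ℝ} (hr : 0 < r) :
    ∃ η : ℝ, 0 < η ∧ ∃ T : ℝ, 0 < T ∧ ∀ ε : ℝ, 0 < ε → ∀ μ : Measure (Sph d),
      IsGibbs lam ω ε μ → ∀ σ : ℝ, (σ = 1 ∨ σ = -1) → ∫ x, al i0 σ x ^ 2 ∂μ ≤ η →
        μ.real {x | r ≤ al i0 σ x ^ 2} ≤ T * ε ^ 2 := by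
  have := hω.1
  have hL := H.2.2.1 i0
  obtain ⟨C, hC, hK⟩ := Kker_dirac lam i0 l H
  set g1 := Real.exp (lam i0 - lam i0 * r) with hg1
  set g2 := Real.exp (lam i0 - lam i0 * (r / 2)) with hg2
  have hg : g1 < g2 := Real.exp_lt_exp.2 (by nlinarith)
  set κ := (g2 - g1) / 4 with hκ
  have hκpos : 0 < κ := by rw [hκ]; linarith
  set s := Real.sqrt (r / 2) with hs
  have hspos : 0 < s := Real.sqrt_pos.2 (by positivity)
  have hs2 : s ^ 2 = r / 2 := Real.sq_sqrt (by positivity)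
  set a : ℝ := min (ω.real {x | al i0 1 x < s}) (ω.real {x | al i0 (-1) x < s}) with ha
  have hapos : 0 < a := lt_min
    (ENNReal.toReal_pos (cap_pos hω i0 (Or.inl rfl) hspos).ne' (measure_ne_top _ _))
    (ENNReal.toReal_pos (cap_pos hω i0 (Or.inr rfl) hspos).ne' (measure_ne_top _ _))
  refine ⟨(κ / C) ^ 2, by positivity, 1 / (2 * κ ^ 2 * a), by positivity, ?_⟩
  intro ε hε μ hG σ hσ hη
  have hp := hG.1
  have hcap : a ≤ ω.real {x | al i0 σ x < s} := by
    rcases hσ with rfl | rfl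
    · exact min_le_left _ _
    · exact min_le_right _ _
  have cal := cont_al i0 σ
  have hal1 : ∫ y, al i0 σ y ∂μ ≤ κ / C := by
    have h1 := int_sq_le μ cal
    exact abs_le_of_sq_le_sq' (h1.trans hη) (by positivity) |>.2
  have hW : ∀ x, |WA lam μ x - Real.exp (lam i0 - lam i0 * al i0 σ x ^ 2)| ≤ κ := by
    intro x
    have cK : Continuous (fun y => Kker lam x y) :=
      (cont_K lam).comp (Continuous.prodMk continuous_const continuous_id)
    have e : WA lam μ x - Real.exp (lam i0 - lam i0 * al i0 σ x ^ 2) =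
        ∫ y, (Kker lam x y - Real.exp (lam i0 - lam i0 * al i0 σ x ^ 2)) ∂μ := by
      rw [integral_sub (cint μ cK) (integrable_const _)]
      simp [WA]
    rw [e]
    refine (abs_integral_le_integral_abs).trans ?_
    have h2 : ∫ y, |Kker lam x y - Real.exp (lam i0 - lam i0 * al i0 σ x ^ 2)| ∂μ ≤
        ∫ y, C * al i0 σ y ∂μ := by
      apply integral_mono (cint μ (by fun_prop)) (cint μ (by fun_prop))
      intro y; exact hK σ hσ x y
    rw [integral_const_mul] at h2
    refine h2.trans ?_
    have h3 := mul_le_mul_of_nonneg_left hal1 hC.le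
    have h4 : C * (κ / C) = κ := by field_simp
    linarith
  have cW := cont_WA lam μ
  set Z := ∫ z, Real.exp (WA lam μ z / ε) ∂ω with hZ
  have hZpos : 0 < Z := gibbs_Z_pos lam ω μ ε
  have hSm : MeasurableSet {x : Sph d | r ≤ al i0 σ x ^ 2} :=
    (isClosed_le continuous_const (by fun_prop)).measurableSet
  have hUm : MeasurableSet {x : Sph d | al i0 σ x < s} :=
    (isOpen_lt cal continuous_const).measurableSet
  -- lower bound on Z
  have hZlow : a * Real.exp ((g2 - κ) / ε) ≤ Z := by
    have h1 : ∫ x, {x : Sph d | al i0 σ x < s}.indicator (fun _ => Real.exp ((g2 - κ) / ε)) x ∂ω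
        ≤ Z := by
      apply integral_mono ((integrable_const _).indicator hUm) (cint ω (by fun_prop))
      intro x
      by_cases hx : x ∈ {x : Sph d | al i0 σ x < s}
      · rw [Set.indicator_of_mem hx]
        apply Real.exp_le_exp.2
        apply div_le_div_of_nonneg_right _ hε.le
        have h2 := (abs_le.1 (hW x)).1
        have h3 : al i0 σ x ^ 2 ≤ r / 2 := by
          rw [← hs2]; exact pow_le_pow_left₀ (al_nonneg _ _ _) (le_of_lt hx) 2
        have h4 : g2 ≤ Real.exp (lam i0 - lam i0 * al i0 σ x ^ 2) := by
          apply Real.exp_le_exp.2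
          have := mul_le_mul_of_nonneg_left h3 hL.le
          linarith
        linarith
      · rw [Set.indicator_of_notMem hx]; positivity
    rw [integral_indicator hUm] at h1
    simp only [setIntegral_const, smul_eq_mul] at h1
    refine le_trans ?_ h1
    gcongr
  have hmass : μ.real {x | r ≤ al i0 σ x ^ 2} ≤ Real.exp ((g1 + κ) / ε) / Z := by
    have hgm : Measurable (fun x => Real.exp (WA lam μ x / ε) / Z) := by
      have : Continuous (fun x => Real.exp (WA lam μ x / ε) / Z) := by fun_prop
      exact this.measurable
    have h0 : μ = dm ω (fun x => Real.exp (WA lam μ x / ε) / Z) := hG.2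
    have h1 : μ.real {x | r ≤ al i0 σ x ^ 2} =
        ∫ x, {x : Sph d | r ≤ al i0 σ x ^ 2}.indicator (fun _ => (1 : ℝ)) x ∂μ := by
      rw [integral_indicator hSm]; simp
    have h2 : ∫ x, {x : Sph d | r ≤ al i0 σ x ^ 2}.indicator (fun _ => (1 : ℝ)) x ∂μ =
        ∫ x, Real.exp (WA lam μ x / ε) / Z *
          {x : Sph d | r ≤ al i0 σ x ^ 2}.indicator (fun _ => (1 : ℝ)) x ∂ω := by
      conv_lhs => rw [h0]
      rw [integral_dm hgm (fun x => by positivity)]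
    rw [h1, h2]
    have h3 : ∫ x, Real.exp (WA lam μ x / ε) / Z *
          {x : Sph d | r ≤ al i0 σ x ^ 2}.indicator (fun _ => (1 : ℝ)) x ∂ω ≤
        ∫ _x, Real.exp ((g1 + κ) / ε) / Z ∂ω := by
      apply integral_mono _ (integrable_const _)
      · intro x
        simp only
        by_cases hx : x ∈ {x : Sph d | r ≤ al i0 σ x ^ 2}
        · rw [Set.indicator_of_mem hx, mul_one]
          apply div_le_div_of_nonneg_right _ hZpos.le
          apply Real.exp_le_exp.2
          apply div_le_div_of_nonneg_right _ hε.le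
          have h2 := (abs_le.1 (hW x)).2
          have h4 : Real.exp (lam i0 - lam i0 * al i0 σ x ^ 2) ≤ g1 := by
            apply Real.exp_le_exp.2
            have h5 : r ≤ al i0 σ x ^ 2 := hx
            have := mul_le_mul_of_nonneg_left h5 hL.le
            linarith
          linarith
        · rw [Set.indicator_of_notMem hx, mul_zero]; positivity
      · refine cint_mul ω (k := fun x => Real.exp (WA lam μ x / ε) / Z) (by fun_prop)
          ((integrable_const _).indicator hSm)
    simpa using h3
  refine hmass.trans ?_
  have h6 : Real.exp ((g1 + κ) / ε) = Real.exp ((g2 - κ) / ε) * Real.exp (-(2 * κ / ε)) := by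
    rw [← Real.exp_add]; congr 1; rw [hκ]; field_simp; ring
  have h7 : Real.exp (-(2 * κ / ε)) * (2 * κ ^ 2) ≤ ε ^ 2 := by
    have h8 := Real.quadratic_le_exp_of_nonneg (x := 2 * κ / ε) (by positivity)
    have h9 : Real.exp (-(2 * κ / ε)) * Real.exp (2 * κ / ε) = 1 := by
      rw [← Real.exp_add]; simp
    have h10 : (2 * κ / ε) ^ 2 / 2 ≤ Real.exp (2 * κ / ε) := by
      have : 0 ≤ 2 * κ / ε := by positivity
      linarith
    have h11 : 2 * κ ^ 2 = ε ^ 2 * ((2 * κ / ε) ^ 2 / 2) := by field_simp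
    rw [h11]
    have h12 := mul_le_mul_of_nonneg_left h10 (Real.exp_pos (-(2 * κ / ε))).le
    rw [h9] at h12
    nlinarith [sq_nonneg ε]
  rw [div_le_iff₀ hZpos]
  have h13 : 1 / (2 * κ ^ 2 * a) * ε ^ 2 * (a * Real.exp ((g2 - κ) / ε)) ≤
      1 / (2 * κ ^ 2 * a) * ε ^ 2 * Z := by gcongr
  refine le_trans ?_ h13
  have h14 : 1 / (2 * κ ^ 2 * a) * ε ^ 2 * (a * Real.exp ((g2 - κ) / ε)) =
      Real.exp ((g2 - κ) / ε) * (ε ^ 2 / (2 * κ ^ 2)) := by field_simp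
  rw [h14, h6]
  gcongr
  rw [le_div_iff₀ (by positivity)]
  exact h7

/-- All concentration facts together. -/
lemma conc_all (lam : Fin d → ℝ) (i0 : Fin d) (l : ℝ) (H : Hyp lam i0 l)
    {ω : Measure (Sph d)} (hω : IsUniform ω) {r : ℝ} (hr : 0 < r) :
    ∃ T : ℝ, 0 < T ∧ ∃ ε0 : ℝ, 0 < ε0 ∧ ∀ ε : ℝ, 0 < ε → ε < ε0 → ∀ μ : Measure (Sph d),
      IsMinimizer lam ω ε μ → ∃ σ : ℝ, (σ = 1 ∨ σ = -1) ∧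
        μ.real {x | r ≤ al i0 σ x ^ 2} ≤ T * ε ^ 2 := by
  have := hω.1
  obtain ⟨η, hη, T, hT, htail⟩ := tail lam i0 l H hω hr
  obtain ⟨C, hC, hconc⟩ := conc lam i0 l H
  obtain ⟨ε0, hε0, hen⟩ := energy_lb lam i0 l H hω (η := η / C) (by positivity)
  refine ⟨T, hT, ε0, hε0, fun ε hε hlt μ hμ => ?_⟩
  obtain ⟨σ, hσ, h1⟩ := hconc μ hμ.1 _ (hen ε hε hlt μ hμ)
  refine ⟨σ, hσ, htail ε hε μ (min_gibbs hε hμ) σ hσ ?_⟩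
  have h4 : C * (η / C) = η := by field_simp
  linarith

/-- Fourth moment from second moment and tail. -/
lemma fourth_le (i0 : Fin d) {σ : ℝ} (hσ : σ = 1 ∨ σ = -1) (μ : Measure (Sph d))
    [IsProbabilityMeasure μ] {r : ℝ} (hr : 0 < r) :
    ∫ x, al i0 σ x ^ 4 ∂μ ≤ r * (∫ x, al i0 σ x ^ 2 ∂μ) +
      4 * μ.real {x | r ≤ al i0 σ x ^ 2} := by
  have cal := cont_al i0 σ
  have hSm : MeasurableSet {x : Sph d | r ≤ al i0 σ x ^ 2} :=
    (isClosed_le continuous_const (by fun_prop)).measurableSet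
  have h1 : μ.real {x | r ≤ al i0 σ x ^ 2} =
      ∫ x, {x : Sph d | r ≤ al i0 σ x ^ 2}.indicator (fun _ => (1 : ℝ)) x ∂μ := by
    rw [integral_indicator hSm]; simp
  have hi : Integrable ({x : Sph d | r ≤ al i0 σ x ^ 2}.indicator (fun _ => (1 : ℝ))) μ :=
    (integrable_const _).indicator hSm
  have hj : Integrable (fun x => al i0 σ x ^ 2) μ := cint μ (by fun_prop)
  rw [h1, ← integral_const_mul, ← integral_const_mul,
    ← integral_add (hj.const_mul r) (hi.const_mul 4)]
  apply integral_mono (cint μ (by fun_prop)) ((hj.const_mul r).add (hi.const_mul 4))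
  intro x
  simp only [Pi.add_apply]
  have h2 := al_sq i0 hσ x
  have h3 := defect_le i0 hσ x
  have h4 : 0 ≤ al i0 σ x ^ 2 := sq_nonneg _
  have h5 : al i0 σ x ^ 4 = al i0 σ x ^ 2 * al i0 σ x ^ 2 := by ring
  by_cases hx : x ∈ {x : Sph d | r ≤ al i0 σ x ^ 2}
  · rw [Set.indicator_of_mem hx, h5]
    have : al i0 σ x ^ 2 ≤ 2 := by linarith
    nlinarith
  · rw [Set.indicator_of_notMem hx, h5]
    have : al i0 σ x ^ 2 < r := by simpa using hx
    nlinarith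

lemma sum_two {p q : Fin d} (hpq : p ≠ q) (f : Fin d → ℝ)
    (hf : ∀ k, k ≠ p → k ≠ q → f k = 0) : ∑ k, f k = f p + f q := by
  apply Finset.sum_eq_add p q hpq
  · intro c _ hc; exact hf c hc.1 hc.2
  · intro h; exact absurd (Finset.mem_univ _) h
  · intro h; exact absurd (Finset.mem_univ _) h

/-- rotation in the `(p,q)` plane as a linear map -/
def rotLin (p q : Fin d) (t : ℝ) : EuclideanSpace ℝ (Fin d) →ₗ[ℝ] EuclideanSpace ℝ (Fin d) where
  toFun x := WithLp.toLp 2 (fun k => if k = p then Real.cos t * x p - Real.sin t * x q else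
    if k = q then Real.sin t * x p + Real.cos t * x q else x k)
  map_add' x y := by
    ext k
    simp only [PiLp.add_apply]
    split_ifs <;> ring
  map_smul' c x := by
    ext k
    simp only [PiLp.smul_apply, smul_eq_mul, RingHom.id_apply]
    split_ifs <;> ring

lemma rotLin_apply (p q : Fin d) (t : ℝ) (x : EuclideanSpace ℝ (Fin d)) (k : Fin d) :
    rotLin p q t x k = if k = p then Real.cos t * x p - Real.sin t * x q else
    if k = q then Real.sin t * x p + Real.cos t * x q else x k := rfl

lemma rotLin_norm {p q : Fin d} (hpq : p ≠ q) (t : ℝ) (x : EuclideanSpace ℝ (Fin d)) :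
    ‖rotLin p q t x‖ = ‖x‖ := by
  have h : ‖rotLin p q t x‖ ^ 2 = ‖x‖ ^ 2 := by
    rw [EuclideanSpace.norm_sq_eq, EuclideanSpace.norm_sq_eq, ← sub_eq_zero,
      ← Finset.sum_sub_distrib, sum_two hpq]
    · simp only [rotLin_apply, if_true, if_neg hpq.symm, Real.norm_eq_abs, sq_abs]
      have := Real.sin_sq_add_cos_sq t
      linear_combination (x p ^ 2 + x q ^ 2) * this
    · intro k h1 h2
      simp [rotLin_apply, h1, h2]
  exact (pow_left_inj₀ (norm_nonneg _) (norm_nonneg _) two_ne_zero).1 h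

/-- rotation as a linear isometry equivalence -/
def rot {p q : Fin d} (hpq : p ≠ q) (t : ℝ) :
    EuclideanSpace ℝ (Fin d) ≃ₗᵢ[ℝ] EuclideanSpace ℝ (Fin d) :=
  LinearIsometry.toLinearIsometryEquiv ⟨rotLin p q t, rotLin_norm hpq t⟩ rfl

/-- rotation on the sphere -/
def rs {p q : Fin d} (hpq : p ≠ q) (t : ℝ) (x : Sph d) : Sph d := sphMap (rot hpq t) x

lemma rs_apply {p q : Fin d} (hpq : p ≠ q) (t : ℝ) (x : Sph d) (k : Fin d) :
    (rs hpq t x).1 k = if k = p then Real.cos t * x.1 p - Real.sin t * x.1 q else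
    if k = q then Real.sin t * x.1 p + Real.cos t * x.1 q else x.1 k := rfl

lemma cont_rs {p q : Fin d} (hpq : p ≠ q) (t : ℝ) : Continuous (rs hpq t) := cont_sphMap _

lemma rs_inv {ω : Measure (Sph d)} (hω : IsUniform ω) {p q : Fin d} (hpq : p ≠ q) (t : ℝ)
    {F : Sph d → ℝ} (hF : Continuous F) : ∫ x, F (rs hpq t x) ∂ω = ∫ x, F x ∂ω := by
  have h1 := hω.2 (rot hpq t)
  have h2 := integral_map (μ := ω) (φ := rs hpq t) (cont_rs hpq t).measurable.aemeasurable (f := F)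
    hF.aestronglyMeasurable
  rw [← h2]
  have h3 : Measure.map (rs hpq t) ω = ω := h1
  rw [h3]

/-- derivative of coordinates along the rotation flow -/
def dz (p q : Fin d) (z : Sph d) (k : Fin d) : ℝ :=
  if k = p then - z.1 q else if k = q then z.1 p else 0

lemma rs_deriv {p q : Fin d} (hpq : p ≠ q) (t : ℝ) (x : Sph d) (k : Fin d) :
    HasDerivAt (fun t => (rs hpq t x).1 k) (dz p q (rs hpq t x) k) t := by
  have hc := Real.hasDerivAt_cos t
  have hs := Real.hasDerivAt_sin t
  unfold dz
  simp only [rs_apply, if_true, if_neg hpq.symm]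
  by_cases h1 : k = p
  · simp only [h1, if_true]
    convert! (hc.mul_const (x.1 p)).sub (hs.mul_const (x.1 q)) using 1
    ring
  · by_cases h2 : k = q
    · simp only [h2, if_true, if_neg hpq.symm]
      convert! (hs.mul_const (x.1 p)).add (hc.mul_const (x.1 q)) using 1
      ring
    · simp only [if_neg h1, if_neg h2]
      exact hasDerivAt_const _ _

/-- bounded by compactness -/
lemma bdd_of_cont {X : Type*} [TopologicalSpace X] [CompactSpace X] {f : X → ℝ}
    (hf : Continuous f) : ∃ C, ∀ x, |f x| ≤ C := by
  obtain ⟨C, hC⟩ := isCompact_univ.exists_bound_of_continuousOn hf.continuousOn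
  exact ⟨C, fun x => hC x (Set.mem_univ x)⟩

/-- Infinitesimal rotation invariance. -/
lemma rot_ibp {ω : Measure (Sph d)} (hω : IsUniform ω) {p q : Fin d} (hpq : p ≠ q)
    {F G : Sph d → ℝ} (hF : Continuous F) (hG : Continuous G)
    (hd : ∀ x t, HasDerivAt (fun t => F (rs hpq t x)) (G (rs hpq t x)) t) :
    ∫ x, G x ∂ω = 0 := by
  have := hω.1
  obtain ⟨C, hC⟩ := bdd_of_cont hG
  have h1 := hasDerivAt_integral_of_dominated_loc_of_deriv_le (μ := ω) (bound := fun _ => C)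
    (F := fun t x => F (rs hpq t x)) (F' := fun t x => G (rs hpq t x)) (x₀ := (0 : ℝ))
    (s := Set.univ) Filter.univ_mem
    (Eventually.of_forall fun t => (hF.comp (cont_rs hpq t)).aestronglyMeasurable)
    (cint ω (hF.comp (cont_rs hpq 0))) ((hG.comp (cont_rs hpq 0)).aestronglyMeasurable)
    (Eventually.of_forall fun x t _ => hC _) (integrable_const _)
    (Eventually.of_forall fun x t _ => hd x t)
  have h2 := h1.2
  simp only [rs_inv hω hpq _ hF, rs_inv hω hpq _ hG] at h2
  exact h2.unique (hasDerivAt_const _ _)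

lemma K_deriv (lam : Fin d → ℝ) {p q : Fin d} (hpq : p ≠ q) (t : ℝ) (x y : Sph d) :
    HasDerivAt (fun t => Kker lam (rs hpq t x) y)
      (Kker lam (rs hpq t x) y * (lam q * (rs hpq t x).1 p * y.1 q -
        lam p * (rs hpq t x).1 q * y.1 p)) t := by
  unfold Kker
  apply HasDerivAt.exp
  have h : HasDerivAt (fun t => ∑ k, lam k * (rs hpq t x).1 k * y.1 k)
      (∑ k, lam k * dz p q (rs hpq t x) k * y.1 k) t := by
    apply HasDerivAt.fun_sum
    intro k _
    exact ((rs_deriv hpq t x k).const_mul (lam k)).mul_const (y.1 k)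
  have e : ∑ k, lam k * dz p q (rs hpq t x) k * y.1 k = lam q * (rs hpq t x).1 p * y.1 q -
        lam p * (rs hpq t x).1 q * y.1 p := by
    rw [sum_two hpq]
    · simp only [dz, if_true, if_neg hpq.symm]; ring
    · intro k h1 h2; simp [dz, h1, h2]
  rw [e] at h
  exact h

/-- derivative of the potential along rotations -/
def GW (lam : Fin d → ℝ) (μ : Measure (Sph d)) (p q : Fin d) (z : Sph d) : ℝ :=
  ∫ y, Kker lam z y * (lam q * z.1 p * y.1 q - lam p * z.1 q * y.1 p) ∂μ

lemma cont_KD (lam : Fin d → ℝ) (p q : Fin d) : Continuous (fun z : Sph d × Sph d =>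
    Kker lam z.1 z.2 * (lam q * z.1.1 p * z.2.1 q - lam p * z.1.1 q * z.2.1 p)) := by
  have := cont_K lam
  fun_prop

lemma cont_GW (lam : Fin d → ℝ) (μ : Measure (Sph d)) [IsProbabilityMeasure μ] (p q : Fin d) :
    Continuous (GW lam μ p q) := by
  have := continuous_parametric_integral_of_continuous (μ := μ)
    (f := fun z y : Sph d => Kker lam z y * (lam q * z.1 p * y.1 q - lam p * z.1 q * y.1 p))
    (cont_KD lam p q) (isCompact_univ (X := Sph d))
  simp only [Measure.restrict_univ] at this
  exact this

lemma W_deriv (lam : Fin d → ℝ) (μ : Measure (Sph d)) [IsProbabilityMeasure μ] {p q : Fin d}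
    (hpq : p ≠ q) (x : Sph d) (t : ℝ) :
    HasDerivAt (fun t => WA lam μ (rs hpq t x)) (GW lam μ p q (rs hpq t x)) t := by
  obtain ⟨C, hC⟩ := bdd_of_cont (cont_KD lam p q)
  have c1 : ∀ z : Sph d, Continuous (fun y => Kker lam z y) := fun z =>
      (cont_K lam).comp (Continuous.prodMk continuous_const continuous_id)
  have c2 : ∀ z : Sph d, Continuous (fun y : Sph d => Kker lam z y *
      (lam q * z.1 p * y.1 q - lam p * z.1 q * y.1 p)) := fun z =>
      (cont_KD lam p q).comp (Continuous.prodMk continuous_const continuous_id)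
  have h1 := hasDerivAt_integral_of_dominated_loc_of_deriv_le (μ := μ) (bound := fun _ => C)
    (F := fun t y => Kker lam (rs hpq t x) y) (F' := fun t y => Kker lam (rs hpq t x) y *
      (lam q * (rs hpq t x).1 p * y.1 q - lam p * (rs hpq t x).1 q * y.1 p)) (x₀ := t)
    (s := Set.univ) Filter.univ_mem
    (Eventually.of_forall fun t => (c1 _).aestronglyMeasurable)
    (cint μ (c1 _)) ((c2 _).aestronglyMeasurable)
    (Eventually.of_forall fun y t _ => hC (rs hpq t x, y)) (integrable_const _)
    (Eventually.of_forall fun y t _ => K_deriv lam hpq t x y)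
  exact h1.2

/-- Stein identity for Gibbs measures. -/
lemma stein {lam : Fin d → ℝ} {ω : Measure (Sph d)} (hω : IsUniform ω) {ε : ℝ} (hε : 0 < ε)
    {μ : Measure (Sph d)} (hG : IsGibbs lam ω ε μ) {p q j : Fin d} (hpq : p ≠ q) (hj : j ≠ p)
    (c : ℝ) :
    ε * (if q = j then 1 else 0) * ∫ x : Sph d, x.1 p ∂μ =
      ∫ z : Sph d × Sph d, Kker lam z.1 z.2 * ((z.1.1 j - c) *
        (lam p * z.1.1 q * z.2.1 p - lam q * z.1.1 p * z.2.1 q)) ∂(μ.prod μ) := by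
  have := hω.1
  have hp := hG.1
  have cW := cont_WA lam μ
  have cG := cont_GW lam μ p q
  set Z := ∫ z, Real.exp (WA lam μ z / ε) ∂ω with hZ
  have hZpos : 0 < Z := gibbs_Z_pos lam ω μ ε
  set D : ℝ := if q = j then 1 else 0 with hD
  have hdz : ∀ z : Sph d, dz p q z j = D * z.1 p := by
    intro z
    unfold dz
    rw [if_neg hj, hD]
    by_cases h : q = j
    · simp [h]
    · simp [h, Ne.symm h]
  have hibp := rot_ibp hω hpq (F := fun z => (z.1 j - c) * Real.exp (WA lam μ z / ε))
    (G := fun z => D * z.1 p * Real.exp (WA lam μ z / ε) + (z.1 j - c) *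
      (Real.exp (WA lam μ z / ε) * (GW lam μ p q z / ε)))
    (by fun_prop) (by fun_prop) (by
      intro x t
      have h1 := (rs_deriv hpq t x j).sub_const c
      have h2 := ((W_deriv lam μ hpq x t).div_const ε).exp
      rw [hdz] at h1
      exact h1.mul h2)
  have hgm : Measurable (fun x => Real.exp (WA lam μ x / ε) / Z) := by
    have : Continuous (fun x => Real.exp (WA lam μ x / ε) / Z) := by fun_prop
    exact this.measurable
  have h0 : μ = dm ω (fun x => Real.exp (WA lam μ x / ε) / Z) := hG.2
  have h2 : ∀ F : Sph d → ℝ, ∫ x, F x ∂μ = ∫ x, Real.exp (WA lam μ x / ε) / Z * F x ∂ω := by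
    intro F
    conv_lhs => rw [h0]
    rw [integral_dm hgm (fun x => by positivity)]
  have h3 : ∫ x : Sph d, (D * x.1 p + (x.1 j - c) * (GW lam μ p q x / ε)) ∂μ = 0 := by
    rw [h2]
    have e : (fun x : Sph d => Real.exp (WA lam μ x / ε) / Z *
        (D * x.1 p + (x.1 j - c) * (GW lam μ p q x / ε))) = fun z =>
        (D * z.1 p * Real.exp (WA lam μ z / ε) + (z.1 j - c) *
      (Real.exp (WA lam μ z / ε) * (GW lam μ p q z / ε))) / Z := by
      funext x; ring
    rw [e, integral_div, hibp, zero_div]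
  have e2 : (fun x : Sph d => (D * x.1 p + (x.1 j - c) * (GW lam μ p q x / ε))) = fun x =>
      D * x.1 p + ((x.1 j - c) * GW lam μ p q x) / ε := by
    funext x; ring
  rw [e2, integral_add (cint μ (by fun_prop)) (cint μ (by fun_prop)), integral_const_mul,
    integral_div] at h3
  have c3 : Continuous (fun z : Sph d × Sph d => Kker lam z.1 z.2 * ((z.1.1 j - c) *
        (lam p * z.1.1 q * z.2.1 p - lam q * z.1.1 p * z.2.1 q))) := by
    have := cont_K lam
    fun_prop
  have h4 : ∫ z : Sph d × Sph d, Kker lam z.1 z.2 * ((z.1.1 j - c) *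
        (lam p * z.1.1 q * z.2.1 p - lam q * z.1.1 p * z.2.1 q)) ∂(μ.prod μ) =
      - ∫ x : Sph d, (x.1 j - c) * GW lam μ p q x ∂μ := by
    rw [integral_prod _ (cint _ c3), ← integral_neg]
    apply integral_congr_ae
    refine Eventually.of_forall fun x => ?_
    simp only [GW]
    rw [← integral_const_mul, ← integral_neg]
    apply integral_congr_ae
    refine Eventually.of_forall fun y => ?_
    simp only; ring
  rw [h4]
  field_simp at h3
  linarith

lemma young_aux (A B c : ℝ) :
    (A ^ 2 + B ^ 2) * ((2 * A + c) * (2 * A + 2 * B)) ≤ 18 * (A ^ 4 + B ^ 4) + c ^ 4 := by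
  have h1 : (2 * A + c) * (2 * A + 2 * B) ≤ 8 * (A ^ 2 + B ^ 2) + c ^ 2 := by
    nlinarith [sq_nonneg (A - B), sq_nonneg (2 * A - c), sq_nonneg (2 * B - c),
      sq_nonneg (A + B - c), sq_nonneg B, sq_nonneg A]
  have h2 : (A ^ 2 + B ^ 2) * ((2 * A + c) * (2 * A + 2 * B)) ≤
      (A ^ 2 + B ^ 2) * (8 * (A ^ 2 + B ^ 2) + c ^ 2) :=
    mul_le_mul_of_nonneg_left h1 (by positivity)
  nlinarith [sq_nonneg (A ^ 2 - B ^ 2), sq_nonneg (A ^ 2 + B ^ 2 - c ^ 2)]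

lemma stein_point (lam : Fin d → ℝ) (i0 : Fin d) (l : ℝ) (H : Hyp lam i0 l) :
    ∃ C : ℝ, 0 < C ∧ ∀ σ : ℝ, (σ = 1 ∨ σ = -1) → ∀ i j : Fin d, i ≠ i0 → j ≠ i0 → ∀ c : ℝ,
      ∀ x y : Sph d,
      |Kker lam x y * ((x.1 j - c) * (lam i0 * x.1 i * y.1 i0 - lam i * x.1 i0 * y.1 i)) * σ -
        Real.exp (lam i0) * ((x.1 j - c) * (lam i0 * x.1 i - lam i * y.1 i))| ≤
        C * (18 * (al i0 σ x ^ 4 + al i0 σ y ^ 4) + c ^ 4) := by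
  have hL := H.2.2.1 i0
  obtain ⟨C1, hC1, hK⟩ := Kker_first lam i0 l H
  refine ⟨(C1 + Real.exp (lam i0)) * lam i0, by positivity, ?_⟩
  intro σ hσ i j hi hj c x y
  have hA := al_nonneg i0 σ x
  have hB := al_nonneg i0 σ y
  have hA2 := al_sq i0 hσ x
  have hB2 := al_sq i0 hσ y
  have hk := hK σ hσ x y
  have hxi := coord_le_al i0 hσ x i hi
  have hxj := coord_le_al i0 hσ x j hj
  have hyi := coord_le_al i0 hσ y i hi
  have hli := lam_le H i
  have hli0 := H.2.2.1 i
  have hx0 := coord_abs_le x i0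
  have hy0 := coord_abs_le y i0
  set A := al i0 σ x
  set B := al i0 σ y
  set S := A ^ 2 + B ^ 2 with hS
  have hSnn : 0 ≤ S := by positivity
  have hσ1 : |σ| = 1 := by rcases hσ with rfl | rfl <;> simp
  have hxjc : |x.1 j - c| ≤ 2 * A + |c| := (abs_sub _ _).trans (by linarith)
  have hE : |lam i0 * x.1 i * y.1 i0 - lam i * x.1 i0 * y.1 i| ≤ lam i0 * (2 * A + 2 * B) := by
    refine (abs_sub _ _).trans ?_
    rw [abs_mul, abs_mul, abs_mul, abs_mul, abs_of_pos hL, abs_of_pos hli0]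
    have h1 : lam i0 * |x.1 i| * |y.1 i0| ≤ lam i0 * (2 * A) * 1 := by gcongr
    have h2 : lam i * |x.1 i0| * |y.1 i| ≤ lam i0 * 1 * (2 * B) := by gcongr
    linarith
  have hE2 : |lam i0 * x.1 i * B ^ 2 - lam i * A ^ 2 * y.1 i| ≤ lam i0 * (2 * A + 2 * B) * S := by
    refine (abs_sub _ _).trans ?_
    rw [abs_mul, abs_mul, abs_mul, abs_mul, abs_of_pos hL, abs_of_pos hli0,
      abs_of_nonneg (sq_nonneg A), abs_of_nonneg (sq_nonneg B)]
    have hb : B ^ 2 ≤ S := by rw [hS]; linarith [sq_nonneg A]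
    have ha : A ^ 2 ≤ S := by rw [hS]; linarith [sq_nonneg B]
    have h1 : lam i0 * |x.1 i| * B ^ 2 ≤ lam i0 * (2 * A) * S := by gcongr
    have h2 : lam i * A ^ 2 * |y.1 i| ≤ lam i0 * S * (2 * B) := by gcongr
    linarith
  have e : Kker lam x y * ((x.1 j - c) * (lam i0 * x.1 i * y.1 i0 - lam i * x.1 i0 * y.1 i)) * σ -
        Real.exp (lam i0) * ((x.1 j - c) * (lam i0 * x.1 i - lam i * y.1 i)) =
      (Kker lam x y - Real.exp (lam i0)) * (x.1 j - c) *
        (lam i0 * x.1 i * y.1 i0 - lam i * x.1 i0 * y.1 i) * σ -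
      Real.exp (lam i0) * (x.1 j - c) * (lam i0 * x.1 i * B ^ 2 - lam i * A ^ 2 * y.1 i) := by
    rw [hA2, hB2]; ring
  rw [e]
  refine (abs_sub _ _).trans ?_
  rw [abs_mul, abs_mul, abs_mul, abs_mul, abs_mul, hσ1, abs_of_pos (Real.exp_pos _)]
  have h1 : |Kker lam x y - Real.exp (lam i0)| * |x.1 j - c| *
      |lam i0 * x.1 i * y.1 i0 - lam i * x.1 i0 * y.1 i| * 1 ≤
      (C1 * S) * (2 * A + |c|) * (lam i0 * (2 * A + 2 * B)) * 1 := by gcongr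
  have h2 : Real.exp (lam i0) * |x.1 j - c| * |lam i0 * x.1 i * B ^ 2 - lam i * A ^ 2 * y.1 i| ≤
      Real.exp (lam i0) * (2 * A + |c|) * (lam i0 * (2 * A + 2 * B) * S) := by gcongr
  have h3 := young_aux A B |c|
  have hc4 : |c| ^ 4 = c ^ 4 := by
    have : |c| ^ 4 = (|c| ^ 2) ^ 2 := by ring
    rw [this, sq_abs]; ring
  rw [hc4] at h3
  have h4 := mul_le_mul_of_nonneg_left h3
    (by positivity : 0 ≤ (C1 + Real.exp (lam i0)) * lam i0)
  refine (add_le_add h1 h2).trans (le_trans (le_of_eq ?_) h4)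
  ring

/-- Quantitative Stein estimate. -/
lemma stein_est (lam : Fin d → ℝ) (i0 : Fin d) (l : ℝ) (H : Hyp lam i0 l)
    {ω : Measure (Sph d)} (hω : IsUniform ω) :
    ∃ C : ℝ, 0 < C ∧ ∀ ε : ℝ, 0 < ε → ∀ μ : Measure (Sph d), IsGibbs lam ω ε μ →
      ∀ σ : ℝ, (σ = 1 ∨ σ = -1) → ∀ i j : Fin d, i ≠ i0 → j ≠ i0 → ∀ c : ℝ,
      c ^ 4 ≤ 16 * ∫ x, al i0 σ x ^ 4 ∂μ →
      |Real.exp (lam i0) * (lam i0 * (∫ x : Sph d, (x.1 j - c) * x.1 i ∂μ) -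
        lam i * ((∫ x : Sph d, (x.1 j - c) ∂μ) * ∫ x : Sph d, x.1 i ∂μ)) -
        ε * (if i = j then 1 else 0) * (σ * ∫ x : Sph d, x.1 i0 ∂μ)| ≤
        C * ∫ x, al i0 σ x ^ 4 ∂μ := by
  obtain ⟨C, hC, hpt⟩ := stein_point lam i0 l H
  refine ⟨C * 52, by positivity, ?_⟩
  intro ε hε μ hG σ hσ i j hi hj c hc
  have hp := hG.1
  have cK := cont_K lam
  have cal := cont_al i0 σ
  have hst := stein hω hε hG (p := i0) (q := i) (j := j) (Ne.symm hi) hj c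
  have i1 : Integrable (fun z : Sph d × Sph d => Kker lam z.1 z.2 * ((z.1.1 j - c) *
        (lam i0 * z.1.1 i * z.2.1 i0 - lam i * z.1.1 i0 * z.2.1 i)) * σ) (μ.prod μ) :=
    cint _ (by fun_prop)
  have i2 : Integrable (fun z : Sph d × Sph d => Real.exp (lam i0) * ((z.1.1 j - c) *
      (lam i0 * z.1.1 i - lam i * z.2.1 i))) (μ.prod μ) := cint _ (by fun_prop)
  have e1 : ∫ z : Sph d × Sph d, Real.exp (lam i0) * ((z.1.1 j - c) *
      (lam i0 * z.1.1 i - lam i * z.2.1 i)) ∂(μ.prod μ) =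
      Real.exp (lam i0) * (lam i0 * (∫ x : Sph d, (x.1 j - c) * x.1 i ∂μ) -
        lam i * ((∫ x : Sph d, (x.1 j - c) ∂μ) * ∫ x : Sph d, x.1 i ∂μ)) := by
    rw [integral_const_mul]
    congr 1
    have e2 : (fun z : Sph d × Sph d => (z.1.1 j - c) * (lam i0 * z.1.1 i - lam i * z.2.1 i)) =
        fun z => lam i0 * ((fun x : Sph d => (x.1 j - c) * x.1 i) z.1 * (fun _ => 1) z.2) -
          lam i * ((fun x : Sph d => x.1 j - c) z.1 * (fun y : Sph d => y.1 i) z.2) := by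
      funext z; simp only; ring
    rw [e2, integral_sub (cint _ (by fun_prop)) (cint _ (by fun_prop)), integral_const_mul,
      integral_const_mul,
      integral_prod_mul (fun x : Sph d => (x.1 j - c) * x.1 i) (fun _ : Sph d => (1 : ℝ)),
      integral_prod_mul (fun x : Sph d => x.1 j - c) (fun y : Sph d => y.1 i)]
    simp
  have e3 : ε * (if i = j then 1 else 0) * (σ * ∫ x : Sph d, x.1 i0 ∂μ) =
      ∫ z : Sph d × Sph d, Kker lam z.1 z.2 * ((z.1.1 j - c) *
        (lam i0 * z.1.1 i * z.2.1 i0 - lam i * z.1.1 i0 * z.2.1 i)) * σ ∂(μ.prod μ) := by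
    rw [integral_mul_const, ← hst]; ring
  rw [abs_sub_comm, e3, ← e1, ← integral_sub i1 i2]
  refine abs_integral_le_integral_abs.trans ?_
  have h1 : ∫ z : Sph d × Sph d, |Kker lam z.1 z.2 * ((z.1.1 j - c) *
        (lam i0 * z.1.1 i * z.2.1 i0 - lam i * z.1.1 i0 * z.2.1 i)) * σ -
        Real.exp (lam i0) * ((z.1.1 j - c) * (lam i0 * z.1.1 i - lam i * z.2.1 i))| ∂(μ.prod μ) ≤
      ∫ z : Sph d × Sph d, C * (18 * (al i0 σ z.1 ^ 4 + al i0 σ z.2 ^ 4) + c ^ 4) ∂(μ.prod μ) := by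
    apply integral_mono (cint _ (by fun_prop)) (cint _ (by fun_prop))
    intro z
    exact hpt σ hσ i j hi hj c z.1 z.2
  refine h1.trans ?_
  have e4 : (fun z : Sph d × Sph d => C * (18 * (al i0 σ z.1 ^ 4 + al i0 σ z.2 ^ 4) + c ^ 4)) =
      fun z => C * (18 * ((fun x => al i0 σ x ^ 4) z.1 * (fun _ => 1) z.2 +
        (fun _ => 1) z.1 * (fun x => al i0 σ x ^ 4) z.2) + c ^ 4) := by
    funext z; simp
  rw [e4, integral_const_mul, integral_add (cint _ (by fun_prop)) (integrable_const _),
    integral_const_mul, integral_add (cint _ (by fun_prop)) (cint _ (by fun_prop)),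
    integral_prod_mul (fun x => al i0 σ x ^ 4) (fun _ : Sph d => (1 : ℝ)),
    integral_prod_mul (fun _ : Sph d => (1 : ℝ)) (fun x => al i0 σ x ^ 4)]
  simp only [integral_const, probReal_univ, smul_eq_mul, mul_one, one_mul]
  nlinarith

lemma sum_sq_al (i0 : Fin d) {σ : ℝ} (hσ : σ = 1 ∨ σ = -1) (μ : Measure (Sph d))
    [IsProbabilityMeasure μ] : ∑ i ∈ Finset.univ.erase i0, ∫ x : Sph d, x.1 i ^ 2 ∂μ =
      2 * (∫ x, al i0 σ x ^ 2 ∂μ) - ∫ x, al i0 σ x ^ 4 ∂μ := by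
  have cal := cont_al i0 σ
  rw [← integral_finsetSum _ (fun i _ => cint μ (by fun_prop)), ← integral_const_mul,
    ← integral_sub (cint μ (by fun_prop)) (cint μ (by fun_prop))]
  congr 1
  funext x
  rw [sph_split]
  have h := al_sq i0 hσ x
  have h4 : al i0 σ x ^ 4 = (al i0 σ x ^ 2) ^ 2 := by ring
  rw [h4, h]
  rcases hσ with rfl | rfl <;> ring

lemma sx0_le (i0 : Fin d) {σ : ℝ} (hσ : σ = 1 ∨ σ = -1) (μ : Measure (Sph d))
    [IsProbabilityMeasure μ] : σ * ∫ x : Sph d, x.1 i0 ∂μ ≤ 1 := by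
  rw [← integral_const_mul]
  have : ∫ x : Sph d, σ * x.1 i0 ∂μ ≤ ∫ _x : Sph d, (1 : ℝ) ∂μ := by
    apply integral_mono (cint μ (by fun_prop)) (integrable_const _)
    intro x
    have := defect_nonneg i0 hσ x
    simp only; linarith
  simpa using this

lemma m4_le (i0 : Fin d) {σ : ℝ} (hσ : σ = 1 ∨ σ = -1) (μ : Measure (Sph d))
    [IsProbabilityMeasure μ] (j : Fin d) (hj : j ≠ i0) :
    (∫ x : Sph d, x.1 j ∂μ) ^ 4 ≤ 16 * ∫ x, al i0 σ x ^ 4 ∂μ := by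
  have cal := cont_al i0 σ
  have h1 := int_sq_le μ (cont_coord j)
  have h2 : ∫ x : Sph d, x.1 j ^ 2 ∂μ ≤ 4 * ∫ x, al i0 σ x ^ 2 ∂μ := by
    rw [← integral_const_mul]
    apply integral_mono (cint μ (by fun_prop)) (cint μ (by fun_prop))
    intro x
    have h := pow_le_pow_left₀ (abs_nonneg _) (coord_le_al i0 hσ x j hj) 2
    rw [sq_abs] at h
    simp only; linarith
  have h3 := int_sq_le μ (f := fun x => al i0 σ x ^ 2) (by fun_prop)
  have e : (fun x => (al i0 σ x ^ 2) ^ 2) = fun x => al i0 σ x ^ 4 := by funext x; ring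
  simp only [e] at h3
  have h5 := pow_le_pow_left₀ (sq_nonneg _) (h1.trans h2) 2
  have h6 : ((∫ x : Sph d, x.1 j ∂μ) ^ 2) ^ 2 = (∫ x : Sph d, x.1 j ∂μ) ^ 4 := by ring
  rw [h6] at h5
  nlinarith

/-- Second moment estimate. -/
lemma second_le (lam : Fin d → ℝ) (i0 : Fin d) (l : ℝ) (H : Hyp lam i0 l)
    {ω : Measure (Sph d)} (hω : IsUniform ω) :
    ∃ C : ℝ, 0 < C ∧ ∀ ε : ℝ, 0 < ε → ∀ μ : Measure (Sph d), IsGibbs lam ω ε μ →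
      ∀ σ : ℝ, (σ = 1 ∨ σ = -1) →
      ∫ x, al i0 σ x ^ 2 ∂μ ≤ C * (ε + ∫ x, al i0 σ x ^ 4 ∂μ) := by
  obtain ⟨C, hC, hst⟩ := stein_est lam i0 l H hω
  have hgap : 0 < lam i0 - l := by linarith [H.2.1]
  set g := Real.exp (lam i0) * (lam i0 - l) with hg
  have hgpos : 0 < g := by positivity
  refine ⟨d * (1 + C) / g + 1, by positivity, ?_⟩
  intro ε hε μ hG σ hσ
  have hp := hG.1
  set F := ∫ x, al i0 σ x ^ 4 ∂μ with hF
  have hFnn : 0 ≤ F := integral_nonneg fun x => by positivity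
  have hi : ∀ i ∈ Finset.univ.erase i0, g * ∫ x : Sph d, x.1 i ^ 2 ∂μ ≤ (1 + C) * (ε + F) := by
    intro i hi
    have hi' := (Finset.mem_erase.1 hi).1
    have h1 := (abs_le.1 (hst ε hε μ hG σ hσ i i hi' hi' 0 (by simpa using hFnn))).2
    simp only [sub_zero, if_true, mul_one] at h1
    have h2 := int_sq_le μ (cont_coord i)
    have h3 := sx0_le i0 hσ μ
    have e : (fun x : Sph d => x.1 i * x.1 i) = fun x => x.1 i ^ 2 := by funext x; ring
    rw [e] at h1
    set m := ∫ x : Sph d, x.1 i ∂μ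
    set V := ∫ x : Sph d, x.1 i ^ 2 ∂μ
    have h4 : lam i * (m * m) ≤ l * V := by
      have h5 := H.2.2.2 i hi'
      have h6 := H.2.2.1 i
      have h7 : 0 ≤ m ^ 2 := sq_nonneg m
      calc lam i * (m * m) = lam i * m ^ 2 := by ring
        _ ≤ l * V := by gcongr
                        exact h6.le.trans h5
    have h8 : g * V ≤ Real.exp (lam i0) * (lam i0 * V - lam i * (m * m)) := by
      rw [hg, mul_assoc]
      gcongr
      linarith
    have h9 := mul_le_mul_of_nonneg_left h3 hε.le
    rw [← hF] at h1
    nlinarith [mul_nonneg hC.le hε.le]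
  have hs := Finset.sum_le_sum hi
  rw [← Finset.mul_sum, sum_sq_al i0 hσ μ, ← hF, Finset.sum_const, nsmul_eq_mul] at hs
  set V := ∫ x, al i0 σ x ^ 2 ∂μ with hV
  have hcard : ((Finset.univ.erase i0).card : ℝ) ≤ d := by
    have := Finset.card_le_univ (Finset.univ.erase i0)
    rw [Fintype.card_fin] at this
    exact_mod_cast this
  have h10 : ((Finset.univ.erase i0).card : ℝ) * ((1 + C) * (ε + F)) ≤
      d * ((1 + C) * (ε + F)) := by gcongr
  have h11 : 2 * V - F ≤ d * (1 + C) / g * (ε + F) := by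
    rw [div_mul_eq_mul_div, le_div_iff₀ hgpos]; linarith
  have hVnn : 0 ≤ V := integral_nonneg fun x => by positivity
  linarith

/-- Moment bounds for minimizers. -/
lemma moments (lam : Fin d → ℝ) (i0 : Fin d) (l : ℝ) (H : Hyp lam i0 l)
    {ω : Measure (Sph d)} (hω : IsUniform ω) :
    ∃ C : ℝ, 0 < C ∧ ∀ η : ℝ, 0 < η → ∃ ε0 : ℝ, 0 < ε0 ∧ ∀ ε : ℝ, 0 < ε → ε < ε0 →
      ∀ μ : Measure (Sph d), IsMinimizer lam ω ε μ → ∃ σ : ℝ, (σ = 1 ∨ σ = -1) ∧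
        ∫ x, al i0 σ x ^ 2 ∂μ ≤ C * ε ∧ ∫ x, al i0 σ x ^ 4 ∂μ ≤ η * ε := by
  have := hω.1
  obtain ⟨C, hC, hsec⟩ := second_le lam i0 l H hω
  refine ⟨4 * C, by positivity, fun η hη => ?_⟩
  set r := min (min (1 / (2 * C)) 1) (η / (4 * C + 1)) with hr
  have hrpos : 0 < r := by rw [hr]; positivity
  have hr1 : r ≤ 1 / (2 * C) := (min_le_left _ _).trans (min_le_left _ _)
  have hr2 : r ≤ 1 := (min_le_left _ _).trans (min_le_right _ _)
  have hr3 : r ≤ η / (4 * C + 1) := min_le_right _ _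
  obtain ⟨T, hT, ε0, hε0, hca⟩ := conc_all lam i0 l H hω hrpos
  refine ⟨min ε0 (r / (4 * T)), by positivity, fun ε hε hlt μ hμ => ?_⟩
  obtain ⟨σ, hσ, htail⟩ := hca ε hε (hlt.trans_le (min_le_left _ _)) μ hμ
  have hlt2 : ε < r / (4 * T) := hlt.trans_le (min_le_right _ _)
  have hp := hμ.1
  have h1 := hsec ε hε μ (min_gibbs hε hμ) σ hσ
  have h2 := fourth_le i0 hσ μ hrpos
  have hVnn : 0 ≤ ∫ x, al i0 σ x ^ 2 ∂μ := integral_nonneg fun x => by positivity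
  set V := ∫ x, al i0 σ x ^ 2 ∂μ
  set F := ∫ x, al i0 σ x ^ 4 ∂μ
  rw [lt_div_iff₀ (by positivity)] at hlt2
  have h3 : 4 * (T * ε ^ 2) ≤ r * ε := by nlinarith
  have h4 : F ≤ r * V + r * ε := by linarith
  have h5 : C * r ≤ 1 / 2 := by
    have := mul_le_mul_of_nonneg_left hr1 hC.le
    have e : C * (1 / (2 * C)) = 1 / 2 := by field_simp
    linarith
  have h6 : V ≤ 4 * C * ε := by
    have h7 : C * F ≤ C * (r * V + r * ε) := mul_le_mul_of_nonneg_left h4 hC.le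
    have h8 : C * r * V ≤ 1 / 2 * V := mul_le_mul_of_nonneg_right h5 hVnn
    have h9 : C * r * ε ≤ C * 1 * ε := by gcongr
    nlinarith
  refine ⟨σ, hσ, h6, ?_⟩
  have h10 : r * V ≤ r * (4 * C * ε) := mul_le_mul_of_nonneg_left h6 hrpos.le
  have h11 : r * (4 * C + 1) ≤ η := (le_div_iff₀ (by positivity)).1 hr3
  have h12 := mul_le_mul_of_nonneg_right h11 hε.le
  nlinarith

/-- The covariance bound. -/
lemma cov_bound (lam : Fin d → ℝ) (i0 : Fin d) (l : ℝ) (H : Hyp lam i0 l)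
    {ω : Measure (Sph d)} (hω : IsUniform ω) :
    ∃ C : ℝ, 0 < C ∧ ∀ ε : ℝ, 0 < ε → ∀ μ : Measure (Sph d), IsGibbs lam ω ε μ →
      ∀ σ : ℝ, (σ = 1 ∨ σ = -1) → ∀ i, i ≠ i0 → ∀ j, j ≠ i0 →
      Real.exp (lam i0) * lam i0 *
        (∫ x : Sph d, (x.1 j - ∫ z : Sph d, z.1 j ∂μ) * (x.1 i - ∫ z : Sph d, z.1 i ∂μ) ∂μ) ≤
        (if i = j then ε else 0) + C * ∫ x, al i0 σ x ^ 4 ∂μ ∧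
      (i ≠ j → -(C * ∫ x, al i0 σ x ^ 4 ∂μ) ≤ Real.exp (lam i0) * lam i0 *
        (∫ x : Sph d, (x.1 j - ∫ z : Sph d, z.1 j ∂μ) * (x.1 i - ∫ z : Sph d, z.1 i ∂μ) ∂μ)) := by
  obtain ⟨C, hC, hst⟩ := stein_est lam i0 l H hω
  refine ⟨C, hC, ?_⟩
  intro ε hε μ hG σ hσ i hi j hj
  have hp := hG.1
  have h1 := hst ε hε μ hG σ hσ i j hi hj _ (m4_le i0 hσ μ j hj)
  have h3 := sx0_le i0 hσ μ
  set mj := ∫ x : Sph d, x.1 j ∂μ with hmj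
  set mi := ∫ x : Sph d, x.1 i ∂μ with hmi
  have e0 : ∫ x : Sph d, (x.1 j - mj) ∂μ = 0 := by
    rw [integral_sub (cint μ (cont_coord j)) (integrable_const _), ← hmj]; simp
  have e1 : ∫ x : Sph d, (x.1 j - mj) * (x.1 i - mi) ∂μ = ∫ x : Sph d, (x.1 j - mj) * x.1 i ∂μ := by
    have e : (fun x : Sph d => (x.1 j - mj) * (x.1 i - mi)) =
        fun x => (x.1 j - mj) * x.1 i - (x.1 j - mj) * mi := by funext x; ring
    rw [e, integral_sub (cint μ (by fun_prop)) (cint μ (by fun_prop)), integral_mul_const, e0]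
    ring
  rw [e0] at h1
  rw [e1]
  simp only [zero_mul, mul_zero, sub_zero, ← mul_assoc] at h1
  have h2 := abs_le.1 h1
  constructor
  · by_cases h : i = j
    · rw [if_pos h] at h2 ⊢
      have h9 := mul_le_mul_of_nonneg_left h3 hε.le
      nlinarith [h2.2]
    · rw [if_neg h] at h2 ⊢
      linarith [h2.2]
  · intro h
    rw [if_neg h] at h2
    linarith [h2.1]

lemma main_aux (lam : Fin d → ℝ) (i0 : Fin d) (l : ℝ) (H : Hyp lam i0 l)
    {ω : Measure (Sph d)} (hω : IsUniform ω) :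
    ∃ εbar : ℝ, 0 < εbar ∧ ∀ ε : ℝ, 0 < ε → ε < εbar →
      ∀ μ : Measure (Sph d), IsMinimizer lam ω ε μ →
        ∀ h : Sph d → ℝ, Measurable h → Integrable (fun x => h x ^ 2) μ → ∫ x, h x ∂μ = 0 →
          ∫ x, ∫ y, Kker lam x y * h x * h y ∂μ ∂μ ≤
            ε * (l / lam i0 + (1 - l / lam i0) / 2) * ∫ x, h x ^ 2 ∂μ := by
  have := hω.1
  have hL := H.2.2.1 i0
  obtain ⟨Cs, hCs, hcov⟩ := cov_bound lam i0 l H hω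
  obtain ⟨Ch, hCh, hhess⟩ := hess_reduce lam i0 l H
  obtain ⟨C, hC, hmom⟩ := moments lam i0 l H hω
  set g := (1 - l / lam i0) / 2 with hg
  have hgpos : 0 < g := by
    have : l / lam i0 < 1 := (div_lt_one hL).2 H.2.1
    rw [hg]; linarith
  set δ := g / (2 * Ch * C) with hδ
  have hδpos : 0 < δ := by positivity
  have hδe : Ch * (δ * C) = g / 2 := by rw [hδ]; field_simp
  set η := (g / 2) / (d * Cs + Ch * δ⁻¹) with hη
  have hden : 0 < d * Cs + Ch * δ⁻¹ := by positivity
  have hηpos : 0 < η := by positivity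
  have hηe : (d * Cs + Ch * δ⁻¹) * η = g / 2 := by rw [hη]; field_simp
  obtain ⟨ε0, hε0, hm⟩ := hmom η hηpos
  refine ⟨ε0, hε0, ?_⟩
  intro ε hε hlt μ hμ h hmeas h2 h0
  have hp := hμ.1
  have hh : Integrable h μ := h_int μ hmeas h2
  have hG := min_gibbs hε hμ
  obtain ⟨σ, hσ, hV, hF⟩ := hm ε hε hlt μ hμ
  have hFnn : 0 ≤ ∫ x, al i0 σ x ^ 4 ∂μ := integral_nonneg fun x => by positivity
  have a1 := hhess σ hσ μ hp h hh h2 h0 δ hδpos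
  have a2 := cov_form lam i0 l H μ ε (Cs * ∫ x, al i0 σ x ^ 4 ∂μ) hε (by positivity)
    (hcov ε hε μ hG σ hσ) h hh h2 h0
  have hQ : 0 ≤ ∫ x, h x ^ 2 ∂μ := integral_nonneg fun x => sq_nonneg _
  refine (a1.trans (add_le_add_left a2 _)).trans ?_
  rw [← add_mul]
  apply mul_le_mul_of_nonneg_right _ hQ
  set V := ∫ x, al i0 σ x ^ 2 ∂μ
  set F := ∫ x, al i0 σ x ^ 4 ∂μ
  have b1 : Ch * (δ * V) ≤ g / 2 * ε := by
    have : Ch * (δ * V) ≤ Ch * (δ * (C * ε)) := by gcongr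
    calc _ ≤ _ := this
      _ = Ch * (δ * C) * ε := by ring
      _ = _ := by rw [hδe]
  have b2 : (d * Cs + Ch * δ⁻¹) * F ≤ g / 2 * ε := by
    have : (d * Cs + Ch * δ⁻¹) * F ≤ (d * Cs + Ch * δ⁻¹) * (η * ε) := by gcongr
    rw [← mul_assoc, hηe] at this
    exact this
  nlinarith

/-- Hessian coercivity bounds at any global minimizer, for small `ε`. -/
theorem stmt1 (d : ℕ) (hd : 2 ≤ d) (lam : Fin d → ℝ)
    (hanti : Antitone lam)
    (hgap : lam ⟨1, by omega⟩ < lam ⟨0, by omega⟩)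
    (hpos : ∀ i, 0 < lam i)
    (ω : Measure (Sph d)) (hω : IsUniform ω) :
    ∃ εbar : ℝ, 0 < εbar ∧ ∀ ε : ℝ, 0 < ε → ε < εbar →
      ∀ μbar : Measure (Sph d), IsMinimizer lam ω ε μbar →
        ∀ h : Sph d → ℝ, Measurable h →
          Integrable (fun x => h x ^ 2) μbar →
          (∫ x, h x ∂μbar) = 0 →
          ε / 2 * (1 - lam ⟨1, by omega⟩ / lam ⟨0, by omega⟩) * ∫ x, h x ^ 2 ∂μbar ≤
              ε * ∫ x, h x ^ 2 ∂μbar -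
                ∫ x, ∫ y, Kker lam x y * h x * h y ∂μbar ∂μbar ∧
            ε * ∫ x, h x ^ 2 ∂μbar -
                ∫ x, ∫ y, Kker lam x y * h x * h y ∂μbar ∂μbar ≤
              ε * ∫ x, h x ^ 2 ∂μbar := by
  have H : Hyp lam ⟨0, by omega⟩ (lam ⟨1, by omega⟩) := by
    refine ⟨hpos _, hgap, hpos, ?_⟩
    intro i hi
    apply hanti
    rw [Fin.le_def]
    have : i.val ≠ 0 := fun h => hi (Fin.ext h)
    show 1 ≤ i.val
    omega
  obtain ⟨εbar, hεbar, hmain⟩ := main_aux lam _ _ H hω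
  refine ⟨εbar, hεbar, ?_⟩
  intro ε hε hlt μ hμ h hmeas h2 h0
  have hp := hμ.1
  have h1 := hmain ε hε hlt μ hμ h hmeas h2 h0
  have h3 := psd_K H μ (h_int μ hmeas h2)
  constructor
  · linarith
  · linarith

end
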